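/- arXiv:2605.13478 — 4 statements merged into one kernel-verified Lean document; each statement's English description precedes it below -/
import Mathlib

section
/- Let α > 0 and κ > 0, let u : [0,T] × ℝ² → ℝ² be continuous, and let ω, m : [0,T] × ℝ² → ℝ be such that m is twice continuously differentiable in x and continuously differentiable in t, and ω is continuously differentiable. Assume that the equations ∂_t ω + u·∇ω = −α Δm and ∂_t m + u·∇m − κ Δm = α ω hold pointwise on [0,T] × ℝ². Then the function Γ := (1/α) ω + (1/κ) m satisfies, pointwise on [0,T] × ℝ², the transport equation ∂_t Γ + u·∇Γ = (α/κ) ω = (α²/κ) Γ − (α²/κ²) m. -/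
open MeasureTheory Real Set
open scoped ENNReal
noncomputable section

/-- The plane `ℝ²`, with its Euclidean structure and Lebesgue measure. -/
abbrev Plane : Type := EuclideanSpace ℝ (Fin 2)

/-- The Biot–Savart kernel `K(z) = (1/(2π)) z^⊥ / |z|²` (set to `0` at `z = 0`). -/
def biotSavartK (z : Plane) : Plane :=
  (2 * Real.pi * ‖z‖ ^ 2)⁻¹ • (EuclideanSpace.equiv (Fin 2) ℝ).symm ![-z 1, z 0]

/-- `i`-th partial derivative of a scalar field on the plane. -/
def pd (i : Fin 2) (f : Plane → ℝ) (x : Plane) : ℝ :=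
  fderiv ℝ f x (EuclideanSpace.single i 1)

/-- Laplacian of a scalar field on the plane. -/
def lap (f : Plane → ℝ) (x : Plane) : ℝ :=
  pd 0 (pd 0 f) x + pd 1 (pd 1 f) x

/-- Partial derivatives of a linear combination of differentiable scalar fields. -/
theorem pd_const_mul_add_const_mul (i : Fin 2) (a b : ℝ) {f g : Plane → ℝ} {x : Plane}
    (hf : DifferentiableAt ℝ f x) (hg : DifferentiableAt ℝ g x) :
    pd i (fun y => a * f y + b * g y) x = a * pd i f x + b * pd i g x := by
  have h := ((hf.hasFDerivAt.const_mul a).add (hg.hasFDerivAt.const_mul b)).fderiv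
  change fderiv ℝ (fun y => a * f y + b * g y) x = _ at h
  simp [pd, h]

/-- If `∂_t ω + u·∇ω = −αΔm` and `∂_t m + u·∇m − κΔm = αω`
hold pointwise on `[0,T] × ℝ²`, then `Γ := (1/α)ω + (1/κ)m` satisfies the
transport equation `∂_t Γ + u·∇Γ = (α/κ)ω = (α²/κ)Γ − (α²/κ²)m` pointwise. -/
theorem gamma_transport_equation (α κ T : ℝ) (hα : 0 < α) (hκ : 0 < κ) (hT : 0 < T)
    (u : ℝ → Plane → Plane) (ω m : ℝ → Plane → ℝ)
    (hu_cont : Continuous ↿u)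
    (hm_t : ∀ x, ContDiff ℝ 1 (fun t => m t x))
    (hm_x : ∀ t, ContDiff ℝ 2 (m t))
    (hω : ContDiff ℝ 1 ↿ω)
    (heqω : ∀ t ∈ Icc (0:ℝ) T, ∀ x : Plane,
      deriv (fun s => ω s x) t
        + (u t x 0 * pd 0 (ω t) x + u t x 1 * pd 1 (ω t) x)
        = -α * lap (m t) x)
    (heqm : ∀ t ∈ Icc (0:ℝ) T, ∀ x : Plane,
      deriv (fun s => m s x) t
        + (u t x 0 * pd 0 (m t) x + u t x 1 * pd 1 (m t) x)
        - κ * lap (m t) x = α * ω t x) :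
    ∀ t ∈ Icc (0:ℝ) T, ∀ x : Plane,
      (deriv (fun s => (1/α) * ω s x + (1/κ) * m s x) t
        + (u t x 0 * pd 0 (fun y => (1/α) * ω t y + (1/κ) * m t y) x
            + u t x 1 * pd 1 (fun y => (1/α) * ω t y + (1/κ) * m t y) x)
        = (α/κ) * ω t x)
      ∧ (α/κ) * ω t x
          = (α^2/κ) * ((1/α) * ω t x + (1/κ) * m t x) - (α^2/κ^2) * m t x := by
  intro t ht x
  have hω_time : DifferentiableAt ℝ (fun s => ω s x) t :=
    (hω.comp (contDiff_id.prodMk contDiff_const)).differentiable one_ne_zero t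
  have hω_space : DifferentiableAt ℝ (ω t) x :=
    (hω.comp (contDiff_const.prodMk contDiff_id)).differentiable one_ne_zero x
  have hm_time : DifferentiableAt ℝ (fun s => m s x) t :=
    (hm_t x).differentiable one_ne_zero t
  have hm_space : DifferentiableAt ℝ (m t) x := (hm_x t).differentiable two_ne_zero x
  have hderiv : deriv (fun s => (1/α) * ω s x + (1/κ) * m s x) t
      = (1/α) * deriv (fun s => ω s x) t + (1/κ) * deriv (fun s => m s x) t :=
    ((hω_time.hasDerivAt.const_mul (1/α)).add (hm_time.hasDerivAt.const_mul (1/κ))).deriv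
  have hα0 := hα.ne'
  have hκ0 := hκ.ne'
  constructor
  · rw [hderiv, pd_const_mul_add_const_mul 0 _ _ hω_space hm_space,
      pd_const_mul_add_const_mul 1 _ _ hω_space hm_space]
    have hcancel : (1/α) * (-α * lap (m t) x) + (1/κ) * (α * ω t x + κ * lap (m t) x)
        = (α/κ) * ω t x := by
      field_simp
      ring
    linear_combination (1/α) * heqω t ht x + (1/κ) * heqm t ht x + hcancel
  · field_simp
    ring
end
end

section
/- Let α > 0, κ > 0, p0 ∈ (1,2) and T > 0. There exist constants C₀ > 0 and K₀ > 0, depending only on α and κ, with the following property. Let (u, m, Π) be a smooth solution on [0,T] × ℝ² of the system ∂_t u + (u·∇)u + ∇Π = −α ∇^⊥m, ∂_t m + u·∇m − κ Δm = α ω, div u = 0, where ω := ∂₁u² − ∂₂u¹, such that u is bounded and, for every t ∈ [0,T], ω(t,·) and m(t,·) are Schwartz functions depending continuously on t. Then sup_{t ∈ [0,T]} ( ‖ω(t,·)‖_{L^{p0} ∩ L^∞} + ‖m(t,·)‖_{L^{p0} ∩ L^∞} ) + κ ( ∫₀ᵀ ‖∇m(t,·)‖²_{L²} dt )^{1/2}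 ≤ C₀ ( ‖ω(0,·)‖_{L^{p0} ∩ L^∞} + ‖m(0,·)‖_{L^{p0} ∩ L^∞} ) e^{K₀ T}. -/
open MeasureTheory Real Set
open scoped ENNReal
noncomputable section

/-- Vorticity `ω = ∂₁u² − ∂₂u¹` of a time-dependent planar vector field. -/
def vort (u : ℝ → Plane → Plane) (t : ℝ) : Plane → ℝ :=
  fun x => pd 0 (fun y => u t y 1) x - pd 1 (fun y => u t y 0) x

/-- The `L^{p0} ∩ L^∞` norm `‖f‖_{L^{p0}} + ‖f‖_{L^∞}`. -/
def npLinf (p0 : ℝ) (f : Plane → ℝ) : ℝ :=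
  (eLpNorm f (ENNReal.ofReal p0) volume).toReal + (eLpNorm f ⊤ volume).toReal

open Filter Topology
open scoped SchwartzMap LineDeriv

lemma integrable_japanese : Integrable (fun x : Plane => (1 + ‖x‖) ^ (-3 : ℝ)) :=
  integrable_one_add_norm (by simp; norm_num)

/-- A continuous curve of Schwartz functions decays uniformly on compact time intervals. -/
lemma exists_uniform_decay {G : ℝ → 𝓢(Plane, ℝ)} (hG : Continuous G) (T : ℝ) :
    ∃ C : ℝ, 0 ≤ C ∧ ∀ t ∈ Icc 0 T, ∀ x, |G t x| ≤ C * (1 + ‖x‖) ^ (-3 : ℝ) := by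
  set q : Seminorm ℝ 𝓢(Plane, ℝ) :=
    (Finset.Iic ((3, 0) : ℕ × ℕ)).sup fun m => SchwartzMap.seminorm ℝ m.1 m.2 with hq
  have hqc : Continuous q := by
    apply Seminorm.continuous_of_le (q := ∑ m ∈ Finset.Iic ((3, 0) : ℕ × ℕ),
      SchwartzMap.seminorm ℝ m.1 m.2)
    · have : (⇑(∑ m ∈ Finset.Iic ((3, 0) : ℕ × ℕ),
          SchwartzMap.seminorm ℝ (E := Plane) (F := ℝ) m.1 m.2)) =
          fun f => ∑ m ∈ Finset.Iic ((3, 0) : ℕ × ℕ), SchwartzMap.seminorm ℝ m.1 m.2 f := by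
        ext f; simp
      rw [this]
      exact continuous_finsetSum _ fun m _ =>
        (schwartz_withSeminorms ℝ Plane ℝ).continuous_seminorm m
    · exact Seminorm.finset_sup_le_sum _ _
  obtain ⟨C, hC⟩ := (isCompact_Icc (a := (0 : ℝ)) (b := T)).exists_bound_of_continuousOn
    (hqc.comp hG).continuousOn
  refine ⟨2 ^ 3 * |C|, by positivity, fun t ht x => ?_⟩
  have h1 := SchwartzMap.one_add_le_sup_seminorm_apply (𝕜 := ℝ) (m := (3, 0)) (k := 3) (n := 0)
    le_rfl le_rfl (G t) x
  have h2 : q (G t) ≤ |C| := (le_abs_self _).trans ((hC t ht).trans (le_abs_self _))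
  rw [norm_iteratedFDeriv_zero, Real.norm_eq_abs] at h1
  have h3 : (1 + ‖x‖) ^ (-3 : ℝ) = ((1 + ‖x‖) ^ 3)⁻¹ := by
    rw [Real.rpow_neg (by positivity)]; norm_cast
  rw [h3, ← div_eq_mul_inv, le_div_iff₀ (by positivity), mul_comm]
  calc _ ≤ _ := h1
    _ ≤ _ := by gcongr

lemma japanese_le_one (x : Plane) : (1 + ‖x‖) ^ (-3 : ℝ) ≤ 1 :=
  Real.rpow_le_one_of_one_le_of_nonpos (by linarith [norm_nonneg x]) (by norm_num)

/-- The partial derivative `pd i` as an operator on Schwartz functions. -/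
def schwartzPd (i : Fin 2) (f : 𝓢(Plane, ℝ)) : 𝓢(Plane, ℝ) :=
  ∂_{(EuclideanSpace.single i (1 : ℝ) : Plane)} f

lemma schwartzPd_apply (i : Fin 2) (f : 𝓢(Plane, ℝ)) (x : Plane) :
    schwartzPd i f x = pd i f x :=
  SchwartzMap.lineDerivOp_apply_eq_fderiv _ _ _

lemma continuous_schwartzPd (i : Fin 2) : Continuous (schwartzPd i) :=
  LineDeriv.continuous_lineDerivOp (E := 𝓢(Plane, ℝ)) (EuclideanSpace.single i (1 : ℝ) : Plane)

lemma pd_mul (i : Fin 2) {f g : Plane → ℝ} {x : Plane} (hf : DifferentiableAt ℝ f x)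
    (hg : DifferentiableAt ℝ g x) :
    pd i (fun y => f y * g y) x = f x * pd i g x + pd i f x * g x := by
  simp only [pd]
  rw [fderiv_fun_mul hf hg]
  simp; ring

lemma pd_comp (i : Fin 2) {φ : ℝ → ℝ} {f : Plane → ℝ} {x : Plane}
    (hφ : DifferentiableAt ℝ φ (f x)) (hf : DifferentiableAt ℝ f x) :
    pd i (fun y => φ (f y)) x = deriv φ (f x) * pd i f x := by
  have : HasFDerivAt (fun y => φ (f y)) _ x := hφ.hasDerivAt.comp_hasFDerivAt x hf.hasFDerivAt
  simp only [pd]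
  rw [this.fderiv]
  simp

lemma continuous_pd (i : Fin 2) {f : Plane → ℝ} (hf : ContDiff ℝ 1 f) : Continuous (pd i f) :=
  (hf.continuous_fderiv one_ne_zero).clm_apply continuous_const

lemma integral_mul_pd_of_hasCompactSupport (i : Fin 2) {χ V : Plane → ℝ} (hχ : ContDiff ℝ 1 χ)
    (hχc : HasCompactSupport χ) (hV : ContDiff ℝ 1 V) :
    ∫ x, χ x * pd i V x = -∫ x, pd i χ x * V x := by
  have hc : HasCompactSupport (pd i χ) := hχc.fderiv_apply (𝕜 := ℝ) _
  exact integral_mul_fderiv_eq_neg_fderiv_mul_of_integrable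
    (((continuous_pd i hχ).mul hV.continuous).integrable_of_hasCompactSupport hc.mul_right)
    ((hχ.continuous.mul (continuous_pd i hV)).integrable_of_hasCompactSupport hχc.mul_right)
    ((hχ.continuous.mul hV.continuous).integrable_of_hasCompactSupport hχc.mul_right)
    (fun x _ => hχ.differentiable one_ne_zero x) (fun x _ => hV.differentiable one_ne_zero x)

/-- An integrable divergence of an integrable `C¹` field has zero integral. -/
lemma integral_div_eq_zero {V₀ V₁ : Plane → ℝ} (h₀ : ContDiff ℝ 1 V₀) (h₁ : ContDiff ℝ 1 V₁)
    (i₀ : Integrable V₀) (i₁ : Integrable V₁)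
    (hd : Integrable fun x => pd 0 V₀ x + pd 1 V₁ x) :
    ∫ x, (pd 0 V₀ x + pd 1 V₁ x) = 0 := by
  let b : ContDiffBump (0 : Plane) := ⟨1, 2, one_pos, one_lt_two⟩
  have hb : ContDiff ℝ 1 b := b.contDiff
  obtain ⟨C, hC⟩ : ∃ C, ∀ i : Fin 2, ∀ x, ‖pd i b x‖ ≤ C := by
    have (i : Fin 2) : ∃ C, ∀ x, ‖pd i b x‖ ≤ C :=
      (b.hasCompactSupport.fderiv_apply (𝕜 := ℝ) _).exists_bound_of_continuous (continuous_pd i hb)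
    choose C hC using this
    exact ⟨max (C 0) (C 1), fun i x => by
      fin_cases i
      · exact (hC 0 x).trans (le_max_left _ _)
      · exact (hC 1 x).trans (le_max_right _ _)⟩
  let r : ℕ → ℝ := fun n => 1 / ((n : ℝ) + 1)
  have hr0 : ∀ n, 0 < r n := fun n => by positivity
  have hr : Tendsto r atTop (𝓝 0) := tendsto_one_div_add_atTop_nhds_zero_nat
  have hr1 : ∀ n, r n ≤ 1 := fun n => by
    simp only [r]; rw [div_le_one (by positivity)]; linarith [(Nat.cast_nonneg n : (0 : ℝ) ≤ n)]
  let χ : ℕ → Plane → ℝ := fun n x => b (r n • x)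
  have hχ : ∀ n, ContDiff ℝ 1 (χ n) := fun n => hb.comp (contDiff_const_smul (r n))
  have hχc : ∀ n, HasCompactSupport (χ n) := fun n =>
    b.hasCompactSupport.comp_smul (hr0 n).ne'
  have hχd : ∀ n i x, pd i (χ n) x = r n * pd i b (r n • x) := fun n i x => by
    have h2 : HasFDerivAt (χ n) ((fderiv ℝ b (r n • x)).comp (r n • ContinuousLinearMap.id ℝ Plane))
        x := (hb.differentiable one_ne_zero (r n • x)).hasFDerivAt.comp x
          ((hasFDerivAt_id x).const_smul (r n))
    simp only [pd]
    rw [h2.fderiv]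
    simp
  have hx0 : ∀ x : Plane, Tendsto (fun n => r n • x) atTop (𝓝 0) := fun x => by
    simpa using hr.smul_const x
  have key : ∀ n, ∫ x, χ n x * (pd 0 V₀ x + pd 1 V₁ x)
      = -(∫ x, pd 0 (χ n) x * V₀ x) - ∫ x, pd 1 (χ n) x * V₁ x := fun n => by
    simp only [mul_add]
    rw [integral_add, integral_mul_pd_of_hasCompactSupport 0 (hχ n) (hχc n) h₀,
      integral_mul_pd_of_hasCompactSupport 1 (hχ n) (hχc n) h₁]
    · ring
    · exact ((hχ n).continuous.mul (continuous_pd 0 h₀)).integrable_of_hasCompactSupport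
        (hχc n).mul_right
    · exact ((hχ n).continuous.mul (continuous_pd 1 h₁)).integrable_of_hasCompactSupport
        (hχc n).mul_right
  have lim1 : Tendsto (fun n => ∫ x, χ n x * (pd 0 V₀ x + pd 1 V₁ x)) atTop
      (𝓝 (∫ x, (pd 0 V₀ x + pd 1 V₁ x))) := by
    refine tendsto_integral_of_dominated_convergence (fun x => ‖pd 0 V₀ x + pd 1 V₁ x‖)
      (fun n => (hχ n).continuous.aestronglyMeasurable.mul hd.aestronglyMeasurable) hd.norm
      (fun n => ae_of_all _ fun x => ?_) (ae_of_all _ fun x => ?_)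
    · rw [norm_mul]
      refine mul_le_of_le_one_left (norm_nonneg _) ?_
      rw [Real.norm_eq_abs, abs_of_nonneg b.nonneg]
      exact b.le_one
    · have : Tendsto (fun n => χ n x) atTop (𝓝 (b 0)) := (hb.continuous.tendsto 0).comp (hx0 x)
      rw [b.one_of_mem_closedBall (by simp [b])] at this
      simpa using this.mul_const (pd 0 V₀ x + pd 1 V₁ x)
  have lim2 (i : Fin 2) (V : Plane → ℝ) (hV : Integrable V) :
      Tendsto (fun n => ∫ x, pd i (χ n) x * V x) atTop (𝓝 0) := by
    rw [← integral_zero Plane ℝ (μ := volume)]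
    refine tendsto_integral_of_dominated_convergence (fun x => C * ‖V x‖)
      (fun n => (continuous_pd i (hχ n)).aestronglyMeasurable.mul hV.aestronglyMeasurable)
      (hV.norm.const_mul C) (fun n => ae_of_all _ fun x => ?_) (ae_of_all _ fun x => ?_)
    · rw [norm_mul, hχd, norm_mul, Real.norm_eq_abs (r n), abs_of_pos (hr0 n)]
      gcongr
      exact (mul_le_of_le_one_left (norm_nonneg _) (hr1 n)).trans (hC i _)
    · have : Tendsto (fun n => r n * pd i b (r n • x) * V x) atTop (𝓝 (0 * pd i b 0 * V x)) :=
        (hr.mul (((continuous_pd i hb).tendsto 0).comp (hx0 x))).mul_const _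
      simpa [hχd] using this
  have lim3 := ((lim2 0 V₀ i₀).neg.sub (lim2 1 V₁ i₁))
  rw [neg_zero, sub_zero] at lim3
  exact tendsto_nhds_unique lim1 (lim3.congr fun n => (key n).symm)

lemma exists_bound_comp {ψ : ℝ → ℝ} (hψ : Continuous ψ) (R : ℝ) :
    ∃ C : ℝ, 0 ≤ C ∧ ∀ s, |s| ≤ R → |ψ s| ≤ C := by
  obtain ⟨C, hC⟩ := (isCompact_Icc (a := -R) (b := R)).exists_bound_of_continuousOn
    hψ.continuousOn
  exact ⟨|C|, abs_nonneg C, fun s hs => (hC s (abs_le.mp hs)).trans (le_abs_self C)⟩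

lemma exists_linear_bound {φ : ℝ → ℝ} (hφ : ContDiff ℝ 1 φ) (h0 : φ 0 = 0) (R : ℝ) :
    ∃ C : ℝ, 0 ≤ C ∧ ∀ s, |s| ≤ R → |φ s| ≤ C * |s| := by
  obtain ⟨C, hC0, hC⟩ := exists_bound_comp (hφ.continuous_deriv le_rfl) R
  refine ⟨C, hC0, fun s hs => ?_⟩
  have := (convex_Icc (-R) R).norm_image_sub_le_of_norm_deriv_le (f := φ) (C := C) (x := 0) (y := s)
    (fun x _ => hφ.differentiable one_ne_zero x) (fun x hx => hC x (abs_le.mpr hx))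
    (by have := (abs_nonneg s).trans hs; constructor <;> linarith) (abs_le.mp hs)
  simpa [h0] using this

lemma schwartz_bounded (F : 𝓢(Plane, ℝ)) : ∃ R : ℝ, 0 ≤ R ∧ ∀ x, |F x| ≤ R := by
  obtain ⟨C, hC0, hC⟩ := F.decay 0 0
  exact ⟨C, hC0.le, fun x => by simpa using hC x⟩

lemma integrable_comp_mul {ψ : ℝ → ℝ} (hψ : Continuous ψ) (F : 𝓢(Plane, ℝ)) {g : Plane → ℝ}
    (hg : Integrable g) : Integrable fun x => ψ (F x) * g x := by
  obtain ⟨R, -, hR⟩ := schwartz_bounded F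
  obtain ⟨C, -, hC⟩ := exists_bound_comp hψ R
  exact hg.bdd_mul (c := C) (hψ.comp F.continuous).aestronglyMeasurable
    (ae_of_all _ fun x => hC _ (hR x))

lemma integrable_comp {φ : ℝ → ℝ} (hφ : ContDiff ℝ 1 φ) (h0 : φ 0 = 0) (F : 𝓢(Plane, ℝ)) :
    Integrable fun x => φ (F x) := by
  obtain ⟨R, -, hR⟩ := schwartz_bounded F
  obtain ⟨C, -, hC⟩ := exists_linear_bound hφ h0 R
  refine (F.integrable.norm.const_mul C).mono'
    (hφ.continuous.comp F.continuous).aestronglyMeasurable (ae_of_all _ fun x => hC _ (hR x))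

lemma integrable_pd (i : Fin 2) (F : 𝓢(Plane, ℝ)) : Integrable (pd i F) :=
  (schwartzPd i F).integrable.congr (ae_of_all _ (schwartzPd_apply i F))

lemma schwartz_contDiff_one (F : 𝓢(Plane, ℝ)) : ContDiff ℝ 1 F := F.smooth 1

lemma schwartzPd_coe (i : Fin 2) (F : 𝓢(Plane, ℝ)) : ⇑(schwartzPd i F) = pd i F :=
  funext (schwartzPd_apply i F)

lemma integrable_lap (F : 𝓢(Plane, ℝ)) : Integrable (lap F) := by
  have := (integrable_pd 0 (schwartzPd 0 F)).add (integrable_pd 1 (schwartzPd 1 F))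
  simp only [schwartzPd_coe] at this
  exact this

lemma contDiff_coord {u : Plane → Plane} (hu : ContDiff ℝ 1 u) (i : Fin 2) :
    ContDiff ℝ 1 fun y => u y i := by
  fun_prop

lemma abs_coord_le (z : Plane) (i : Fin 2) : |z i| ≤ ‖z‖ := PiLp.norm_apply_le z i

lemma integrable_advection {u : Plane → Plane} (hu : ContDiff ℝ 1 u) {B : ℝ}
    (hB : ∀ x, ‖u x‖ ≤ B) (i : Fin 2) {g : Plane → ℝ} (hg : Integrable g) :
    Integrable fun x => u x i * g x :=
  hg.bdd_mul (c := B) (contDiff_coord hu i).continuous.aestronglyMeasurable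
    (ae_of_all _ fun x => (abs_coord_le _ i).trans (hB x))

lemma integral_transport_eq_zero {u : Plane → Plane} (hu : ContDiff ℝ 1 u) {B : ℝ}
    (hB : ∀ x, ‖u x‖ ≤ B)
    (hdiv : ∀ x, pd 0 (fun y => u y 0) x + pd 1 (fun y => u y 1) x = 0)
    {φ : ℝ → ℝ} (hφ : ContDiff ℝ 1 φ) (h0 : φ 0 = 0) (F : 𝓢(Plane, ℝ)) :
    ∫ x, deriv φ (F x) * (u x 0 * pd 0 F x + u x 1 * pd 1 F x) = 0 := by
  have hF := schwartz_contDiff_one F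
  have hφF : ContDiff ℝ 1 fun x => φ (F x) := hφ.comp hF
  have hu' := contDiff_coord hu
  have hpd (i : Fin 2) (x : Plane) : pd i (fun y => u y i * φ (F y)) x =
      u x i * (deriv φ (F x) * pd i F x) + pd i (fun y => u y i) x * φ (F x) := by
    rw [pd_mul i ((hu' i).differentiable one_ne_zero x) (hφF.differentiable one_ne_zero x),
      pd_comp i (hφ.differentiable one_ne_zero _) (hF.differentiable one_ne_zero x)]
  have heq (x : Plane) : pd 0 (fun y => u y 0 * φ (F y)) x + pd 1 (fun y => u y 1 * φ (F y)) x
      = deriv φ (F x) * (u x 0 * pd 0 F x + u x 1 * pd 1 F x) := by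
    rw [hpd, hpd]
    linear_combination φ (F x) * hdiv x
  have hi := integrable_comp hφ h0 F
  have := integral_div_eq_zero ((hu' 0).mul hφF) ((hu' 1).mul hφF)
    (integrable_advection hu hB 0 hi) (integrable_advection hu hB 1 hi) (by
      simp only [heq]
      exact integrable_comp_mul (hφ.continuous_deriv le_rfl) F
        ((integrable_advection hu hB 0 (integrable_pd 0 F)).add
          (integrable_advection hu hB 1 (integrable_pd 1 F))))
  simpa only [heq] using this

lemma integrable_pd_sq (i : Fin 2) (F : 𝓢(Plane, ℝ)) : Integrable fun x => pd i F x ^ 2 := by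
  have := integrable_comp_mul continuous_id (schwartzPd i F) (schwartzPd i F).integrable
  simpa only [id, schwartzPd_coe, ← sq] using this

lemma integral_diffusion {φ : ℝ → ℝ} (hφ : ContDiff ℝ 2 φ) (F : 𝓢(Plane, ℝ)) :
    ∫ x, deriv φ (F x) * lap F x =
      -∫ x, deriv (deriv φ) (F x) * (pd 0 F x ^ 2 + pd 1 F x ^ 2) := by
  have hF := schwartz_contDiff_one F
  have hφ' : ContDiff ℝ 1 (deriv φ) := by
    have : ContDiff ℝ (1 + 1) φ := by simpa [one_add_one_eq_two] using hφ
    exact (contDiff_succ_iff_deriv.mp this).2.2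
  have hφF : ContDiff ℝ 1 fun x => deriv φ (F x) := hφ'.comp hF
  have hp (i : Fin 2) : ContDiff ℝ 1 (pd i F) := by
    rw [← schwartzPd_coe]; exact schwartz_contDiff_one _
  have hpd (i : Fin 2) (x : Plane) : pd i (fun y => deriv φ (F y) * pd i F y) x =
      deriv φ (F x) * pd i (pd i F) x + deriv (deriv φ) (F x) * pd i F x ^ 2 := by
    rw [pd_mul i (hφF.differentiable one_ne_zero x) ((hp i).differentiable one_ne_zero x),
      pd_comp i (hφ'.differentiable one_ne_zero _) (hF.differentiable one_ne_zero x)]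
    ring
  have heq (x : Plane) : pd 0 (fun y => deriv φ (F y) * pd 0 F y) x +
      pd 1 (fun y => deriv φ (F y) * pd 1 F y) x = deriv φ (F x) * lap F x +
        deriv (deriv φ) (F x) * (pd 0 F x ^ 2 + pd 1 F x ^ 2) := by
    rw [hpd, hpd, lap]; ring
  have i1 := integrable_comp_mul hφ'.continuous F (integrable_lap F)
  have i2 := integrable_comp_mul (hφ'.continuous_deriv le_rfl) F
    ((integrable_pd_sq 0 F).add (integrable_pd_sq 1 F))
  simp only [Pi.add_apply] at i2
  have := integral_div_eq_zero (hφF.mul (hp 0)) (hφF.mul (hp 1))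
    (integrable_comp_mul hφ'.continuous F (integrable_pd 0 F))
    (integrable_comp_mul hφ'.continuous F (integrable_pd 1 F)) (by
      simp only [heq]; exact i1.add i2)
  simp only [heq] at this
  rw [integral_add i1 i2] at this
  linarith

lemma continuous_schwartz_apply {F : ℝ → 𝓢(Plane, ℝ)} (hF : Continuous F) (x : Plane) :
    Continuous fun t => F t x := by
  have : Continuous fun t => SchwartzMap.toBoundedContinuousFunctionCLM ℝ Plane ℝ (F t) :=
    (SchwartzMap.toBoundedContinuousFunctionCLM ℝ Plane ℝ).continuous.comp hF
  exact (BoundedContinuousFunction.evalCLM ℝ x).continuous.comp this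

lemma continuousOn_integral_comp {F : ℝ → 𝓢(Plane, ℝ)} (hF : Continuous F) (T : ℝ) {φ : ℝ → ℝ}
    (hφ : ContDiff ℝ 1 φ) (h0 : φ 0 = 0) :
    ContinuousOn (fun t => ∫ x, φ (F t x)) (Icc 0 T) := by
  obtain ⟨R, hR0, hR⟩ := exists_uniform_decay hF T
  obtain ⟨C, hC0, hC⟩ := exists_linear_bound hφ h0 R
  refine continuousOn_of_dominated (bound := fun x => C * (R * (1 + ‖x‖) ^ (-3 : ℝ)))
    (fun t _ => (hφ.continuous.comp (F t).continuous).aestronglyMeasurable)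
    (fun t ht => ae_of_all _ fun x => ?_) ((integrable_japanese.const_mul R).const_mul C)
    (ae_of_all _ fun x => (hφ.continuous.comp (continuous_schwartz_apply hF x)).continuousOn)
  refine (hC _ ((hR t ht x).trans (mul_le_of_le_one_right hR0 (japanese_le_one x)))).trans ?_
  gcongr
  exact hR t ht x

lemma hasDerivAt_integral_comp {F : ℝ → 𝓢(Plane, ℝ)} (hF : Continuous F) {T : ℝ} {φ : ℝ → ℝ}
    (hφ : ContDiff ℝ 1 φ) (h0 : φ 0 = 0) {g : ℝ → Plane → ℝ} (hg : ∀ t, Continuous (g t)) {C : ℝ}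
    (hgC : ∀ t ∈ Icc 0 T, ∀ x, |g t x| ≤ C * (1 + ‖x‖) ^ (-3 : ℝ))
    (hd : ∀ t ∈ Icc 0 T, ∀ x, HasDerivAt (fun s => F s x) (g t x) t) {t : ℝ} (ht : t ∈ Ioo 0 T) :
    HasDerivAt (fun s => ∫ x, φ (F s x)) (∫ x, deriv φ (F t x) * g t x) t := by
  obtain ⟨R, hR0, hR⟩ := exists_uniform_decay hF T
  have hφ' := hφ.continuous_deriv le_rfl
  obtain ⟨C', hC0, hC'⟩ := exists_bound_comp hφ' R
  refine (hasDerivAt_integral_of_dominated_loc_of_deriv_le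
    (F := fun s x => φ (F s x)) (F' := fun s x => deriv φ (F s x) * g s x)
    (bound := fun x => C' * (C * (1 + ‖x‖) ^ (-3 : ℝ))) (Ioo_mem_nhds ht.1 ht.2)
    (Eventually.of_forall fun s => (hφ.continuous.comp (F s).continuous).aestronglyMeasurable)
    (integrable_comp hφ h0 (F t))
    ((hφ'.comp (F t).continuous).mul (hg t)).aestronglyMeasurable
    (ae_of_all _ fun x s hs => ?_) ((integrable_japanese.const_mul C).const_mul C')
    (ae_of_all _ fun x s hs => ?_)).2
  · have hs' := Ioo_subset_Icc_self hs
    rw [norm_mul]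
    exact mul_le_mul
      (hC' _ ((hR s hs' x).trans (mul_le_of_le_one_right hR0 (japanese_le_one x))))
      (hgC s hs' x) (abs_nonneg _) hC0
  · exact (hφ.differentiable one_ne_zero _).hasDerivAt.comp s
      (hd s (Ioo_subset_Icc_self hs) x)

/-- The balance law for `∫ φ(F)` along an advection–diffusion equation with source `H`. -/
lemma hasDerivAt_entropy {F H : ℝ → 𝓢(Plane, ℝ)} (hF : Continuous F) (hH : Continuous H) {T : ℝ}
    {u : ℝ → Plane → Plane} (hu : ∀ t, ContDiff ℝ 1 (u t)) {B : ℝ} (hB : ∀ t x, ‖u t x‖ ≤ B)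
    (hdiv : ∀ t x, pd 0 (fun y => u t y 0) x + pd 1 (fun y => u t y 1) x = 0) {ν : ℝ}
    (hd : ∀ t ∈ Icc 0 T, ∀ x, HasDerivAt (fun s => F s x)
      (ν * lap (F t) x + H t x - (u t x 0 * pd 0 (F t) x + u t x 1 * pd 1 (F t) x)) t)
    {φ : ℝ → ℝ} (hφ : ContDiff ℝ 2 φ) (h0 : φ 0 = 0) {t : ℝ} (ht : t ∈ Ioo 0 T) :
    HasDerivAt (fun s => ∫ x, φ (F s x)) ((∫ x, deriv φ (F t x) * H t x) -
      ν * ∫ x, deriv (deriv φ) (F t x) * (pd 0 (F t) x ^ 2 + pd 1 (F t) x ^ 2)) t := by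
  have hφ1 : ContDiff ℝ 1 φ := hφ.of_le one_le_two
  have hφ' := hφ1.continuous_deriv le_rfl
  have hp (i : Fin 2) : Continuous fun t => schwartzPd i (F t) := (continuous_schwartzPd i).comp hF
  have hpp (i : Fin 2) : Continuous fun t => schwartzPd i (schwartzPd i (F t)) :=
    (continuous_schwartzPd i).comp (hp i)
  obtain ⟨C0, hC0, h1⟩ := exists_uniform_decay (hp 0) T
  obtain ⟨C1, hC1, h2⟩ := exists_uniform_decay (hp 1) T
  obtain ⟨C2, hC2, h3⟩ := exists_uniform_decay (hpp 0) T
  obtain ⟨C3, hC3, h4⟩ := exists_uniform_decay (hpp 1) T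
  obtain ⟨C4, hC4, h5⟩ := exists_uniform_decay hH T
  simp only [schwartzPd_coe] at h1 h2 h3 h4
  have hcp (t : ℝ) (i : Fin 2) : Continuous (pd i (F t)) := by
    rw [← schwartzPd_coe]; exact (schwartzPd i (F t)).continuous
  have hcl (t : ℝ) : Continuous (lap (F t)) := by
    have := (schwartzPd 0 (schwartzPd 0 (F t))).continuous.add
      (schwartzPd 1 (schwartzPd 1 (F t))).continuous
    simp only [schwartzPd_coe] at this
    exact this
  have hB0 : 0 ≤ B := (norm_nonneg _).trans (hB 0 0)
  have hcu (t : ℝ) (i : Fin 2) := (contDiff_coord (hu t) i).continuous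
  have key := hasDerivAt_integral_comp hF hφ1 h0 (T := T)
    (g := fun t x => ν * lap (F t) x + H t x - (u t x 0 * pd 0 (F t) x + u t x 1 * pd 1 (F t) x))
    (C := |ν| * (C2 + C3) + C4 + B * (C0 + C1))
    (fun t => (((hcl t).const_mul ν).add (H t).continuous).sub
      (((hcu t 0).mul (hcp t 0)).add ((hcu t 1).mul (hcp t 1))))
    (fun s hs x => by
      set J := (1 + ‖x‖) ^ (-3 : ℝ)
      have hJ : 0 ≤ J := by positivity
      have e1 : |ν * lap (F s) x| ≤ |ν| * (C2 * J + C3 * J) := by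
        rw [abs_mul, lap]
        gcongr
        exact (abs_add_le _ _).trans (add_le_add (h3 s hs x) (h4 s hs x))
      have e2 (i : Fin 2) {a b : ℝ} (hab : |a| ≤ b) : |u s x i * a| ≤ B * b := by
        rw [abs_mul]
        exact mul_le_mul ((abs_coord_le _ i).trans (hB s x)) hab (abs_nonneg _) hB0
      have e3 := e2 0 (h1 s hs x)
      have e4 := e2 1 (h2 s hs x)
      have e5 := h5 s hs x
      rw [abs_le] at *
      constructor <;> nlinarith) hd ht
  convert key using 1
  have i1 := (integrable_comp_mul hφ' (F t) (integrable_lap (F t))).const_mul ν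
  have i2 := integrable_comp_mul hφ' (F t) (H t).integrable
  have i3 := integrable_comp_mul hφ' (F t)
        ((integrable_advection (hu t) (hB t) 0 (integrable_pd 0 (F t))).add
          (integrable_advection (hu t) (hB t) 1 (integrable_pd 1 (F t))))
  simp only [Pi.add_apply] at i3
  have i4 := i1.add i2
  simp only [Pi.add_def] at i4
  have hz := integral_transport_eq_zero (hu t) (hB t) (hdiv t) hφ1 h0 (F t)
  have hl := integral_diffusion hφ (F t)
  have hsplit : (fun x => deriv φ (F t x) * (ν * lap (F t) x + H t x -
      (u t x 0 * pd 0 (F t) x + u t x 1 * pd 1 (F t) x))) = fun x =>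
      (ν * (deriv φ (F t x) * lap (F t) x) + deriv φ (F t x) * H t x) -
        deriv φ (F t x) * (u t x 0 * pd 0 (F t) x + u t x 1 * pd 1 (F t) x) := by
    ext x; ring
  rw [hsplit, integral_sub i4 i3, integral_add i1 i2, integral_const_mul, hz, hl]
  ring

/-- An even, convex `C²` function vanishing at `0` and growing at most like the power `q`. -/
structure IsEntropy (φ : ℝ → ℝ) (q : ℝ) : Prop where
  contDiff : ContDiff ℝ 2 φ
  zero : φ 0 = 0
  convex : ∀ s, 0 ≤ deriv (deriv φ) s
  even : ∀ s, φ (-s) = φ s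
  growth : ∀ s, s * deriv φ s ≤ q * φ s

namespace IsEntropy

variable {φ : ℝ → ℝ} {q : ℝ}

lemma contDiff_one (h : IsEntropy φ q) : ContDiff ℝ 1 φ := h.contDiff.of_le one_le_two

lemma abs_deriv_mul_le (h : IsEntropy φ q) (s r : ℝ) :
    |deriv φ s * r| ≤ q * (φ s + φ r) := by
  have hodd (s : ℝ) : deriv φ (-s) = -deriv φ s := by
    have h1 : deriv (fun x => φ (-x)) s = -deriv φ (-s) := deriv_comp_neg φ s
    rw [funext h.even] at h1
    linarith
  have hd0 : deriv φ 0 = 0 := by have := hodd 0; rw [neg_zero] at this; linarith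
  have hφ2 : ContDiff ℝ (1 + 1) φ := by simpa [one_add_one_eq_two] using h.contDiff
  have hmono : Monotone (deriv φ) :=
    monotone_of_deriv_nonneg ((contDiff_succ_iff_deriv.mp hφ2).2.2.differentiable one_ne_zero)
      h.convex
  have hnn {s : ℝ} (hs : 0 ≤ s) : 0 ≤ deriv φ s := hd0 ▸ hmono hs
  have habs (s : ℝ) : |deriv φ s| = deriv φ |s| := by
    rcases le_total 0 s with hs | hs
    · rw [abs_of_nonneg hs, abs_of_nonneg (hnn hs)]
    · rw [abs_of_nonpos hs, hodd, abs_of_nonpos]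
      have := hnn (neg_nonneg.mpr hs)
      rw [hodd] at this
      linarith
  have hφabs (s : ℝ) : φ |s| = φ s := by
    rcases abs_choice s with hs | hs <;> rw [hs]
    exact h.even s
  have hself (s : ℝ) : |s| * deriv φ |s| ≤ q * φ s := hφabs s ▸ h.growth |s|
  have hpos (s : ℝ) : 0 ≤ q * φ s :=
    (mul_nonneg (abs_nonneg s) (hnn (abs_nonneg s))).trans (hself s)
  rw [abs_mul, habs]
  rcases le_total |r| |s| with hrs | hrs
  · have := mul_le_mul_of_nonneg_left hrs (hnn (abs_nonneg s))
    nlinarith [hself s, hpos r]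
  · have := mul_le_mul_of_nonneg_right (hmono hrs) (abs_nonneg r)
    nlinarith [hself r, hpos s]

end IsEntropy

lemma isEntropy_even_pow {k : ℕ} (hk : 1 ≤ k) : IsEntropy (fun s => s ^ (2 * k)) (2 * k) where
  contDiff := by fun_prop
  zero := by simp; omega
  convex s := by
    have h1 : deriv (fun s : ℝ => s ^ (2 * k)) = fun s => ((2 * k : ℕ) : ℝ) * s ^ (2 * k - 1) := by
      ext s; simp
    have h2 : 2 * k - 1 - 1 = 2 * (k - 1) := by omega
    rw [h1, deriv_const_mul _ (by fun_prop)]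
    simp only [deriv_pow_field, h2]
    have := (even_two_mul (k - 1)).pow_nonneg s
    positivity
  even s := (even_two_mul k).neg_pow s
  growth s := by
    simp only [deriv_pow_field]
    have h2 : s ^ (2 * k) = s * s ^ (2 * k - 1) := by
      rw [← pow_succ']; congr 1; omega
    rw [h2]; push_cast
    exact le_of_eq (by ring)

/-- A smooth regularization of `|s| ^ (2 * r)`. -/
def regPow (r y s : ℝ) : ℝ := (s ^ 2 + y) ^ r - y ^ r

lemma deriv_regPow {r y : ℝ} (hy : 0 < y) :
    deriv (regPow r y) = fun s => 2 * r * (s * (s ^ 2 + y) ^ (r - 1)) := by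
  ext s
  have h1 : HasDerivAt (fun s : ℝ => s ^ 2 + y) (2 * s) s := by
    simpa using (hasDerivAt_pow 2 s).add_const y
  have h2 := (h1.rpow_const (p := r) (Or.inl (by positivity))).sub_const (y ^ r)
  rw [show regPow r y = fun s => (s ^ 2 + y) ^ r - y ^ r from rfl, h2.deriv]
  ring

lemma isEntropy_regPow {r y : ℝ} (hr : 1 / 2 ≤ r) (hr1 : r ≤ 1) (hy : 0 < y) :
    IsEntropy (regPow r y) 2 where
  contDiff := ((contDiff_id.pow 2).add contDiff_const).rpow_const_of_ne
    (fun s => by simp only [id]; positivity) |>.sub contDiff_const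
  zero := by simp [regPow]
  convex s := by
    have h1 : HasDerivAt (fun s : ℝ => s ^ 2 + y) (2 * s) s := by
      simpa using (hasDerivAt_pow 2 s).add_const y
    have hpos : 0 < s ^ 2 + y := by positivity
    have h2 := (((hasDerivAt_id s).mul (h1.rpow_const (p := r - 1) (Or.inl hpos.ne'))).const_mul
      (2 * r)).deriv
    rw [deriv_regPow hy]
    simp only [id, Pi.mul_def] at h2
    rw [h2]
    have h3 : (s ^ 2 + y) ^ (r - 1) = (s ^ 2 + y) * (s ^ 2 + y) ^ (r - 1 - 1) := by
      nth_rw 2 [Real.rpow_sub_one hpos.ne']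
      field_simp
    have h4 : 0 < (s ^ 2 + y) ^ (r - 1 - 1) := Real.rpow_pos_of_pos hpos _
    rw [h3]
    have : 2 * r * (1 * ((s ^ 2 + y) * (s ^ 2 + y) ^ (r - 1 - 1)) +
        s * (2 * s * (r - 1) * (s ^ 2 + y) ^ (r - 1 - 1))) =
        2 * r * (((2 * r - 1) * s ^ 2 + y) * (s ^ 2 + y) ^ (r - 1 - 1)) := by ring
    rw [this]
    have h5 : 0 ≤ 2 * r - 1 := by linarith
    positivity
  even s := by simp [regPow]
  growth s := by
    rw [deriv_regPow hy, regPow]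
    have hpos : 0 < s ^ 2 + y := by positivity
    have hB := rpow_one_add_le_one_add_mul_self (s := y / (s ^ 2 + y) - 1) (p := r)
      (by have : 0 < y / (s ^ 2 + y) := by positivity
          linarith) (by linarith) hr1
    rw [add_sub_cancel, Real.div_rpow hy.le hpos.le, div_le_iff₀ (Real.rpow_pos_of_pos hpos r)] at hB
    have h3 : (s ^ 2 + y) ^ (r - 1) = (s ^ 2 + y) ^ r / (s ^ 2 + y) := Real.rpow_sub_one hpos.ne' r
    have h4 : (1 + r * (y / (s ^ 2 + y) - 1)) * (s ^ 2 + y) ^ r =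
        (s ^ 2 + y) ^ r - r * s ^ 2 * (s ^ 2 + y) ^ (r - 1) := by
      rw [h3]; field_simp; ring
    rw [h4] at hB
    linarith

lemma regPow_nonneg {r y : ℝ} (hr : 0 ≤ r) (hy : 0 ≤ y) (s : ℝ) : 0 ≤ regPow r y s :=
  sub_nonneg.mpr (Real.rpow_le_rpow hy (by nlinarith [sq_nonneg s]) hr)

lemma sq_rpow_half (p s : ℝ) : (s ^ 2) ^ (p / 2) = |s| ^ p := by
  rw [← sq_abs, ← Real.rpow_natCast, ← Real.rpow_mul (abs_nonneg s)]
  congr 1; push_cast; ring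

lemma regPow_le {p y : ℝ} (hp : 0 ≤ p) (hp2 : p ≤ 2) (hy : 0 ≤ y) (s : ℝ) :
    regPow (p / 2) y s ≤ |s| ^ p := by
  rw [regPow, ← sq_rpow_half, sub_le_iff_le_add]
  exact Real.rpow_add_le_add_rpow (sq_nonneg s) hy (by linarith) (by linarith)

/-- A Schwartz-class solution `(W, M)` of the vorticity–microrotation system on `[0, T]`,
advected by the bounded solenoidal field `u`. -/
structure IsFlow (α κ T : ℝ) (u : ℝ → Plane → Plane) (W M : ℝ → 𝓢(Plane, ℝ)) : Prop where
  contDiff : ∀ t, ContDiff ℝ 1 (u t)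
  bounded : ∃ B : ℝ, ∀ t x, ‖u t x‖ ≤ B
  solenoidal : ∀ t x, pd 0 (fun y => u t y 0) x + pd 1 (fun y => u t y 1) x = 0
  continuous_vort : Continuous W
  continuous_micro : Continuous M
  vort_eq : ∀ t ∈ Icc 0 T, ∀ x, HasDerivAt (fun s => W s x)
    (-α * lap (M t) x - (u t x 0 * pd 0 (W t) x + u t x 1 * pd 1 (W t) x)) t
  micro_eq : ∀ t ∈ Icc 0 T, ∀ x, HasDerivAt (fun s => M s x)
    (κ * lap (M t) x + α * W t x - (u t x 0 * pd 0 (M t) x + u t x 1 * pd 1 (M t) x)) t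

namespace IsFlow

variable {α κ T : ℝ} {u : ℝ → Plane → Plane} {W M : ℝ → 𝓢(Plane, ℝ)}

/-- The good unknown `Γ = ω + (α/κ) m`, whose equation has no second-order term. -/
def good (α κ : ℝ) (W M : ℝ → 𝓢(Plane, ℝ)) (t : ℝ) : 𝓢(Plane, ℝ) := W t + (α / κ) • M t

lemma good_apply (t : ℝ) (x : Plane) : good α κ W M t x = W t x + α / κ * M t x := by
  simp [good]

lemma continuous_good (h : IsFlow α κ T u W M) : Continuous (good α κ W M) :=
  h.continuous_vort.add (h.continuous_micro.const_smul (α / κ))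

lemma pd_good (t : ℝ) (i : Fin 2) (x : Plane) :
    pd i (good α κ W M t) x = pd i (W t) x + α / κ * pd i (M t) x := by
  have hW := (W t).differentiableAt (x := x)
  have hM := (M t).differentiableAt (x := x)
  have : ⇑(good α κ W M t) = fun x => W t x + α / κ * M t x := funext (good_apply t)
  simp only [pd, this]
  rw [fderiv_fun_add hW (hM.const_mul _), fderiv_const_mul hM]
  simp

lemma good_eq (h : IsFlow α κ T u W M) (hκ : κ ≠ 0) {t : ℝ} (ht : t ∈ Icc 0 T) (x : Plane) :
    HasDerivAt (fun s => good α κ W M s x) (0 * lap (good α κ W M t) x +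
      ((α * (α / κ)) • W t) x - (u t x 0 * pd 0 (good α κ W M t) x +
        u t x 1 * pd 1 (good α κ W M t) x)) t := by
  have := (h.vort_eq t ht x).fun_add ((h.micro_eq t ht x).const_mul (α / κ))
  simp only [good_apply, pd_good]
  refine this.congr_deriv ?_
  rw [show ((α * (α / κ)) • W t) x = α * (α / κ) * W t x from rfl]
  field_simp
  ring

/-- The growth rate of all the entropies of a flow. -/
def rate (α κ : ℝ) : ℝ := α * (α / κ) * (2 + α / κ) + α * (1 + 2 * (α / κ))

/-- The total entropy of a flow. -/
def entropy (α κ : ℝ) (W M : ℝ → 𝓢(Plane, ℝ)) (φ : ℝ → ℝ) (t : ℝ) : ℝ :=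
  (∫ x, φ (good α κ W M t x)) + ∫ x, φ (M t x)

lemma hasDerivAt_entropy_good (h : IsFlow α κ T u W M) (hκ : κ ≠ 0) {φ : ℝ → ℝ} {q : ℝ}
    (hφ : IsEntropy φ q) {t : ℝ} (ht : t ∈ Ioo 0 T) :
    HasDerivAt (fun s => ∫ x, φ (good α κ W M s x))
      (∫ x, deriv φ (good α κ W M t x) * (α * (α / κ) * W t x)) t := by
  obtain ⟨B, hB⟩ := h.bounded
  simpa using hasDerivAt_entropy h.continuous_good
    (h.continuous_vort.const_smul (α * (α / κ))) h.contDiff hB h.solenoidal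
    (fun t ht x => h.good_eq hκ ht x) hφ.contDiff hφ.zero ht

lemma hasDerivAt_entropy_micro (h : IsFlow α κ T u W M) {φ : ℝ → ℝ} {q : ℝ}
    (hφ : IsEntropy φ q) {t : ℝ} (ht : t ∈ Ioo 0 T) :
    HasDerivAt (fun s => ∫ x, φ (M s x)) ((∫ x, deriv φ (M t x) * (α * W t x)) -
      κ * ∫ x, deriv (deriv φ) (M t x) * (pd 0 (M t) x ^ 2 + pd 1 (M t) x ^ 2)) t := by
  obtain ⟨B, hB⟩ := h.bounded
  exact hasDerivAt_entropy h.continuous_micro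
    (h.continuous_vort.const_smul α) h.contDiff hB h.solenoidal
    h.micro_eq hφ.contDiff hφ.zero ht

lemma entropy_le (h : IsFlow α κ T u W M) (hα : 0 < α) (hκ : 0 < κ) {φ : ℝ → ℝ} {q : ℝ}
    (hφ : IsEntropy φ q) {t : ℝ} (ht : t ∈ Icc 0 T) :
    entropy α κ W M φ t ≤ Real.exp (q * rate α κ * t) * entropy α κ W M φ 0 := by
  set K := q * rate α κ with hK
  have hφ' := hφ.contDiff_one.continuous_deriv le_rfl
  have hd (t : ℝ) (ht : t ∈ Ioo 0 T) : ∃ E', E' ≤ K * entropy α κ W M φ t ∧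
      HasDerivAt (entropy α κ W M φ) E' t := by
    refine ⟨_, ?_, (h.hasDerivAt_entropy_good hκ.ne' hφ ht).add (h.hasDerivAt_entropy_micro hφ ht)⟩
    have hdiss : 0 ≤ κ * ∫ x, deriv (deriv φ) (M t x) * (pd 0 (M t) x ^ 2 + pd 1 (M t) x ^ 2) :=
      mul_nonneg hκ.le (integral_nonneg fun x => mul_nonneg (hφ.convex _) (by positivity))
    have i1 := integrable_comp_mul hφ' (good α κ W M t)
      ((W t).integrable (μ := volume) |>.const_mul (α * (α / κ)))
    have i2 := integrable_comp_mul hφ' (M t) ((W t).integrable (μ := volume) |>.const_mul α)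
    have i3 := integrable_comp hφ.contDiff_one hφ.zero (good α κ W M t)
    have i4 := integrable_comp hφ.contDiff_one hφ.zero (M t)
    have : (∫ x, deriv φ (good α κ W M t x) * (α * (α / κ) * W t x)) +
        ∫ x, deriv φ (M t x) * (α * W t x) ≤ K * entropy α κ W M φ t := by
      rw [entropy, ← integral_add i1 i2, ← integral_add i3 i4, ← integral_const_mul]
      refine integral_mono (i1.add i2) ((i3.add i4).const_mul K) fun x => ?_
      have hc : 0 < α / κ := by positivity
      have hW : W t x = good α κ W M t x - α / κ * M t x := by rw [good_apply]; ring
      simp only [hK, rate, hW]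
      set c := α / κ
      generalize good α κ W M t x = g
      generalize M t x = m
      have e1 := (abs_le.mp (hφ.abs_deriv_mul_le g g)).2
      have e2 := (abs_le.mp (hφ.abs_deriv_mul_le g m)).1
      have e3 := (abs_le.mp (hφ.abs_deriv_mul_le m g)).2
      have e4 := (abs_le.mp (hφ.abs_deriv_mul_le m m)).1
      have e1' := mul_le_mul_of_nonneg_left e1 (mul_pos hα hc).le
      have e2' := mul_le_mul_of_nonneg_left e2 (mul_pos (mul_pos hα hc) hc).le
      have e3' := mul_le_mul_of_nonneg_left e3 hα.le
      have e4' := mul_le_mul_of_nonneg_left e4 (mul_pos hα hc).le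
      have e5 : 0 ≤ α * c * (2 * (q * (φ m + φ m))) := by
        have := (abs_nonneg _).trans (hφ.abs_deriv_mul_le m m)
        positivity
      have e6 : 0 ≤ α * c * (q * (φ g + φ g)) := by
        have := (abs_nonneg _).trans (hφ.abs_deriv_mul_le g g)
        positivity
      nlinarith
    linarith
  have hcont : ContinuousOn (entropy α κ W M φ) (Icc 0 T) :=
    (continuousOn_integral_comp h.continuous_good T hφ.contDiff_one hφ.zero).add
      (continuousOn_integral_comp h.continuous_micro T hφ.contDiff_one hφ.zero)
  have hexp (t : ℝ) : HasDerivAt (fun s => Real.exp (-(K * s))) (-K * Real.exp (-(K * t))) t := by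
    have := (((hasDerivAt_id t).const_mul K).neg).exp
    simp only [Pi.neg_apply, id, mul_one] at this
    rw [mul_comm]; exact this
  have hanti : AntitoneOn (fun s => Real.exp (-(K * s)) * entropy α κ W M φ s) (Icc 0 T) := by
    refine antitoneOn_of_deriv_nonpos (convex_Icc 0 T)
      ((by fun_prop : Continuous fun s => Real.exp (-(K * s))).continuousOn.mul hcont) ?_ ?_
    · rw [interior_Icc]
      intro s hs
      obtain ⟨E', -, hE⟩ := hd s hs
      exact ((hexp s).mul hE).differentiableAt.differentiableWithinAt
    · rw [interior_Icc]
      intro s hs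
      obtain ⟨E', hE', hE⟩ := hd s hs
      rw [((hexp s).fun_mul hE).deriv]
      nlinarith [Real.exp_pos (-(K * s))]
  have := hanti (left_mem_Icc.mpr (ht.1.trans ht.2)) ht ht.1
  simp only [mul_zero, neg_zero, Real.exp_zero, one_mul, Real.exp_neg] at this
  rwa [inv_mul_le_iff₀ (Real.exp_pos _)] at this

end IsFlow

lemma integrable_abs_rpow (F : 𝓢(Plane, ℝ)) {p : ℝ} (hp : 0 < p) :
    Integrable fun x => |F x| ^ p := by
  have := (F.memLp (ENNReal.ofReal p) volume).integrable_norm_rpow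
    (by simpa using hp) ENNReal.ofReal_ne_top
  simpa [ENNReal.toReal_ofReal hp.le] using this

lemma eLpNorm_toReal_rpow (F : 𝓢(Plane, ℝ)) {p : ℝ} (hp : 0 < p) :
    (eLpNorm F (ENNReal.ofReal p) volume).toReal ^ p = ∫ x, |F x| ^ p := by
  have h0 : 0 ≤ ∫ x, |F x| ^ p := integral_nonneg fun x => by positivity
  rw [MemLp.eLpNorm_eq_integral_rpow_norm (by simpa using hp) ENNReal.ofReal_ne_top
    (F.memLp (ENNReal.ofReal p) volume)]
  simp only [ENNReal.toReal_ofReal hp.le, Real.norm_eq_abs]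
  rw [ENNReal.toReal_ofReal (by positivity), ← Real.rpow_mul h0, inv_mul_cancel₀ hp.ne',
    Real.rpow_one]

lemma ae_abs_le_eLpNorm_top (F : 𝓢(Plane, ℝ)) :
    ∀ᵐ x, |F x| ≤ (eLpNorm F ⊤ volume).toReal := by
  have h := (F.memLp ⊤ volume).2.ne
  filter_upwards [ae_le_eLpNormEssSup (f := F) (μ := volume)] with x hx
  have := ENNReal.toReal_mono (by simpa using h) hx
  simpa using this

lemma tendsto_integral_regPow (F : 𝓢(Plane, ℝ)) {p : ℝ} (hp : 0 < p) (hp2 : p ≤ 2) :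
    Tendsto (fun n : ℕ => ∫ x, regPow (p / 2) (1 / ((n : ℝ) + 1)) (F x)) atTop
      (𝓝 (∫ x, |F x| ^ p)) := by
  have hc (s : ℝ) : Continuous fun y : ℝ => regPow (p / 2) y s :=
    ((continuous_const.add continuous_id).rpow_const fun _ => Or.inr (by positivity)).sub
      (continuous_id.rpow_const fun _ => Or.inr (by positivity))
  have hs (y : ℝ) : Continuous (regPow (p / 2) y) :=
    (((continuous_id.pow 2).add continuous_const).rpow_const
      fun _ => Or.inr (by positivity)).sub continuous_const
  refine tendsto_integral_of_dominated_convergence (fun x => |F x| ^ p)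
    (fun n => ((hs _).comp F.continuous).aestronglyMeasurable) (integrable_abs_rpow F hp)
    (fun n => ae_of_all _ fun x => ?_) (ae_of_all _ fun x => ?_)
  · rw [Real.norm_eq_abs, abs_of_nonneg (regPow_nonneg (by positivity) (by positivity) _)]
    exact regPow_le hp.le hp2 (by positivity) _
  · have := ((hc (F x)).tendsto 0).comp (tendsto_one_div_add_atTop_nhds_zero_nat (𝕜 := ℝ))
    have h0 : regPow (p / 2) 0 (F x) = |F x| ^ p := by
      rw [regPow, add_zero, sq_rpow_half, Real.zero_rpow (by positivity), sub_zero]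
    rwa [h0] at this

/-- Geometric control of all even moments gives a pointwise bound. -/
lemma abs_le_of_even_moments {F : 𝓢(Plane, ℝ)} {R S : ℝ} (hR : 0 < R)
    (h : ∀ k : ℕ, 1 ≤ k → ∫ x, F x ^ (2 * k) ≤ R ^ (2 * k) * S) (x : Plane) : |F x| ≤ R := by
  by_contra! hx
  obtain ⟨R', hRR', hR'⟩ := exists_between hx
  set U : Set Plane := {y | R' < |F y|}
  have hU : IsOpen U := isOpen_lt continuous_const F.continuous.abs
  have hUpos : 0 < volume U := hU.measure_pos volume ⟨x, hR'⟩
  have hR'0 : 0 < R' := hR.trans hRR'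
  have hintg (k : ℕ) (hk : 1 ≤ k) : Integrable fun y => F y ^ (2 * k) :=
    integrable_comp (isEntropy_even_pow hk).contDiff_one (isEntropy_even_pow hk).zero F
  have hsub (k : ℕ) : U ⊆ {y | R' ^ (2 * k) ≤ F y ^ (2 * k)} := fun y hy => by
    have := pow_le_pow_left₀ hR'0.le (le_of_lt (show R' < |F y| from hy)) (2 * k)
    rwa [(even_two_mul k).pow_abs] at this
  have hfin (k : ℕ) (hk : 1 ≤ k) : volume {y | R' ^ (2 * k) ≤ F y ^ (2 * k)} < ⊤ :=
    (hintg k hk).measure_ge_lt_top (by positivity)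
  have hUfin : volume U < ⊤ := (measure_mono (hsub 1)).trans_lt (hfin 1 le_rfl)
  have hreal : 0 < volume.real U := ENNReal.toReal_pos hUpos.ne' hUfin.ne
  have hbound (k : ℕ) (hk : 1 ≤ k) : ((R' / R) ^ 2) ^ k * volume.real U ≤ S := by
    have h1 := mul_meas_ge_le_integral_of_nonneg (μ := volume) (f := fun y => F y ^ (2 * k))
      (ae_of_all _ fun y => (even_two_mul k).pow_nonneg _) (hintg k hk) (R' ^ (2 * k))
    have h2 : volume.real U ≤ volume.real {y | R' ^ (2 * k) ≤ F y ^ (2 * k)} :=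
      measureReal_mono (hsub k) (hfin k hk).ne
    have h3 := (mul_le_mul_of_nonneg_left h2 (by positivity : 0 ≤ R' ^ (2 * k))).trans
      (h1.trans (h k hk))
    rw [← pow_mul, div_pow, div_mul_eq_mul_div, div_le_iff₀ (by positivity)]
    linarith
  have hgt : 1 < (R' / R) ^ 2 := one_lt_pow₀ ((one_lt_div hR).mpr hRR') two_ne_zero
  obtain ⟨k, hk⟩ := ((tendsto_pow_atTop_atTop_of_one_lt hgt).eventually_gt_atTop
    (S / volume.real U)).and (eventually_ge_atTop 1) |>.exists
  have := hbound k hk.2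
  rw [← le_div_iff₀ hreal] at this
  linarith [hk.1]

lemma integral_even_pow_le (F : 𝓢(Plane, ℝ)) {L : ℝ} (hL : 0 < L) (hF : ∀ᵐ x, |F x| ≤ L) {k : ℕ}
    (hk : 1 ≤ k) : ∫ x, F x ^ (2 * k) ≤ L ^ (2 * k) * ((∫ x, F x ^ 2) / L ^ 2) := by
  have h2 : Integrable fun x => F x ^ 2 := by
    simpa using integrable_comp (isEntropy_even_pow le_rfl).contDiff_one
      (isEntropy_even_pow le_rfl).zero F
  have : L ^ (2 * k) * ((∫ x, F x ^ 2) / L ^ 2) = ∫ x, L ^ (2 * k - 2) * F x ^ 2 := by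
    rw [integral_const_mul, ← Nat.sub_add_cancel (show 2 ≤ 2 * k by omega), pow_add]
    simp only [Nat.add_sub_cancel]
    field_simp
  rw [this]
  refine integral_mono_ae
    (integrable_comp (isEntropy_even_pow hk).contDiff_one (isEntropy_even_pow hk).zero F)
    (h2.const_mul _) ?_
  filter_upwards [hF] with x hx
  have h3 : F x ^ (2 * k) = |F x| ^ (2 * k - 2) * F x ^ 2 := by
    rw [← sq_abs (F x), ← pow_add, Nat.sub_add_cancel (by omega), (even_two_mul k).pow_abs]
  rw [h3]
  gcongr

lemma integral_sq_le_npLinf_sq (F : 𝓢(Plane, ℝ)) {p : ℝ} (hp : 0 < p) (hp2 : p < 2) :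
    ∫ x, F x ^ 2 ≤ npLinf p F ^ 2 := by
  set L := (eLpNorm F ⊤ volume).toReal with hL
  set a := (eLpNorm F (ENNReal.ofReal p) volume).toReal with ha
  have ha0 : 0 ≤ a := ENNReal.toReal_nonneg
  have hL0 : 0 ≤ L := ENNReal.toReal_nonneg
  have h2 : Integrable fun x => F x ^ 2 := by
    simpa using integrable_comp (isEntropy_even_pow le_rfl).contDiff_one
      (isEntropy_even_pow le_rfl).zero F
  have h1 : ∫ x, F x ^ 2 ≤ ∫ x, L ^ (2 - p) * |F x| ^ p := by
    refine integral_mono_ae h2 ((integrable_abs_rpow F hp).const_mul _) ?_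
    filter_upwards [ae_abs_le_eLpNorm_top F] with x hx
    have : F x ^ 2 = |F x| ^ (2 - p) * |F x| ^ p := by
      rw [← sq_abs, ← Real.rpow_add_of_nonneg (abs_nonneg _) (by linarith) hp.le]
      simp
    rw [this]
    gcongr
  rw [integral_const_mul, ← eLpNorm_toReal_rpow F hp, ← ha] at h1
  have hN : npLinf p F = a + L := rfl
  calc _ ≤ _ := h1
    _ ≤ (a + L) ^ (2 - p) * (a + L) ^ p := by
      gcongr <;> linarith
    _ = npLinf p F ^ 2 := by
      rw [← Real.rpow_add_of_nonneg (by positivity) (by linarith) hp.le, hN]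
      simp

lemma npLinf_nonneg (p : ℝ) (f : Plane → ℝ) : 0 ≤ npLinf p f :=
  add_nonneg ENNReal.toReal_nonneg ENNReal.toReal_nonneg

lemma npLinf_add_const_smul_le (F G : 𝓢(Plane, ℝ)) (c : ℝ) {p : ℝ} (hp : 1 ≤ p) :
    npLinf p (fun x => F x + c * G x) ≤ npLinf p F + |c| * npLinf p G := by
  have key (q : ℝ≥0∞) (hq : 1 ≤ q) : (eLpNorm (fun x => F x + c * G x) q volume).toReal ≤
      (eLpNorm F q volume).toReal + |c| * (eLpNorm G q volume).toReal := by
    have h1 := eLpNorm_add_le F.continuous.aestronglyMeasurable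
      (c • G).continuous.aestronglyMeasurable (μ := volume) hq
    have h2 : eLpNorm (c • G) q volume = ‖c‖ₑ * eLpNorm G q volume :=
      eLpNorm_const_smul c (⇑G) q volume
    rw [h2] at h1
    have hF := (F.memLp q volume).2.ne
    have hG := (G.memLp q volume).2.ne
    have h3 := ENNReal.toReal_mono
      (ENNReal.add_ne_top.mpr ⟨hF, ENNReal.mul_ne_top enorm_ne_top hG⟩) h1
    rw [ENNReal.toReal_add hF (ENNReal.mul_ne_top enorm_ne_top hG), ENNReal.toReal_mul] at h3
    simpa [Pi.add_def] using h3
  have k1 := key (ENNReal.ofReal p) (by simpa using hp)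
  have k2 := key ⊤ le_top
  simp only [npLinf]
  linarith

namespace IsFlow

variable {α κ T : ℝ} {u : ℝ → Plane → Plane} {W M : ℝ → 𝓢(Plane, ℝ)}

lemma rate_pos (hα : 0 < α) (hκ : 0 < κ) : 0 < rate α κ := by
  unfold rate; positivity

lemma eLpNorm_le (h : IsFlow α κ T u W M) (hα : 0 < α) (hκ : 0 < κ) {p : ℝ} (hp : 1 < p)
    (hp2 : p < 2) {t : ℝ} (ht : t ∈ Icc 0 T) {F : 𝓢(Plane, ℝ)}
    (hF : F = good α κ W M t ∨ F = M t) :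
    (eLpNorm F (ENNReal.ofReal p) volume).toReal ≤ Real.exp (2 * rate α κ * t) *
      ((eLpNorm (good α κ W M 0) (ENNReal.ofReal p) volume).toReal +
        (eLpNorm (M 0) (ENNReal.ofReal p) volume).toReal) := by
  have hp0 : 0 < p := by linarith
  set a := (eLpNorm (good α κ W M 0) (ENNReal.ofReal p) volume).toReal with ha
  set b := (eLpNorm (M 0) (ENNReal.ofReal p) volume).toReal with hb
  have ha0 : 0 ≤ a := ENNReal.toReal_nonneg
  have hb0 : 0 ≤ b := ENNReal.toReal_nonneg
  have hmain : (∫ x, |good α κ W M t x| ^ p) + ∫ x, |M t x| ^ p ≤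
      Real.exp (2 * rate α κ * t) * (a ^ p + b ^ p) := by
    rw [ha, hb, eLpNorm_toReal_rpow _ hp0, eLpNorm_toReal_rpow _ hp0]
    exact le_of_tendsto_of_tendsto'
      ((tendsto_integral_regPow _ hp0 hp2.le).add (tendsto_integral_regPow _ hp0 hp2.le))
      (((tendsto_integral_regPow _ hp0 hp2.le).add
        (tendsto_integral_regPow _ hp0 hp2.le)).const_mul _)
      fun n => h.entropy_le hα hκ (isEntropy_regPow (r := p / 2) (y := 1 / ((n : ℝ) + 1))
        (by linarith) (by linarith) (by positivity)) ht
  have hF' : ∫ x, |F x| ^ p ≤ (∫ x, |good α κ W M t x| ^ p) + ∫ x, |M t x| ^ p := by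
    have h1 : 0 ≤ ∫ x, |good α κ W M t x| ^ p := integral_nonneg fun x => by positivity
    have h2 : 0 ≤ ∫ x, |M t x| ^ p := integral_nonneg fun x => by positivity
    rcases hF with rfl | rfl <;> linarith
  have he : 1 ≤ Real.exp (2 * rate α κ * t) :=
    Real.one_le_exp (mul_nonneg (mul_nonneg zero_le_two (rate_pos hα hκ).le) ht.1)
  rw [← Real.rpow_le_rpow_iff ENNReal.toReal_nonneg (by positivity) hp0, eLpNorm_toReal_rpow _ hp0,
    Real.mul_rpow (by positivity) (by positivity)]
  refine (hF'.trans hmain).trans ?_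
  gcongr
  · exact Real.self_le_rpow_of_one_le he hp.le
  · exact Real.add_rpow_le_rpow_add ha0 hb0 hp.le

lemma eLpNorm_top_le (h : IsFlow α κ T u W M) (hα : 0 < α) (hκ : 0 < κ)
    {t : ℝ} (ht : t ∈ Icc 0 T) {F : 𝓢(Plane, ℝ)} (hF : F = good α κ W M t ∨ F = M t) :
    (eLpNorm F ⊤ volume).toReal ≤ Real.exp (rate α κ * t) *
      ((eLpNorm (good α κ W M 0) ⊤ volume).toReal + (eLpNorm (M 0) ⊤ volume).toReal) := by
  set a := (eLpNorm (good α κ W M 0) ⊤ volume).toReal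
  set b := (eLpNorm (M 0) ⊤ volume).toReal
  have ha0 : 0 ≤ a := ENNReal.toReal_nonneg
  have hb0 : 0 ≤ b := ENNReal.toReal_nonneg
  have key (L : ℝ) (hL : a + b < L) :
      (eLpNorm F ⊤ volume).toReal ≤ Real.exp (rate α κ * t) * L := by
    have hL0 : 0 < L := by linarith
    have hpt : ∀ x, |F x| ≤ Real.exp (rate α κ * t) * L := by
      refine abs_le_of_even_moments (by positivity)
        (S := ((∫ x, good α κ W M 0 x ^ 2) + ∫ x, M 0 x ^ 2) / L ^ 2) fun k hk => ?_
      have h1 := h.entropy_le hα hκ (isEntropy_even_pow hk) ht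
      have h2 : ∫ x, F x ^ (2 * k) ≤ entropy α κ W M (fun s => s ^ (2 * k)) t := by
        have h1 : 0 ≤ ∫ x, good α κ W M t x ^ (2 * k) :=
          integral_nonneg fun x => (even_two_mul k).pow_nonneg _
        have h2 : 0 ≤ ∫ x, M t x ^ (2 * k) :=
          integral_nonneg fun x => (even_two_mul k).pow_nonneg _
        rw [entropy]
        rcases hF with rfl | rfl <;> linarith
      have h3 : entropy α κ W M (fun s => s ^ (2 * k)) 0 ≤
          L ^ (2 * k) * (((∫ x, good α κ W M 0 x ^ 2) + ∫ x, M 0 x ^ 2) / L ^ 2) := by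
        rw [entropy, add_div, mul_add]
        exact add_le_add
          (integral_even_pow_le _ hL0 ((ae_abs_le_eLpNorm_top _).mono fun x hx =>
            hx.trans (by linarith)) hk)
          (integral_even_pow_le _ hL0 ((ae_abs_le_eLpNorm_top _).mono fun x hx =>
            hx.trans (by linarith)) hk)
      have h4 : Real.exp (2 * k * rate α κ * t) = Real.exp (rate α κ * t) ^ (2 * k) := by
        rw [← Real.exp_nat_mul]; push_cast; ring_nf
      rw [mul_pow, mul_assoc, ← h4]
      exact h2.trans (h1.trans (by gcongr))
    refine ENNReal.toReal_le_of_le_ofReal (by positivity) ?_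
    exact eLpNormEssSup_le_of_ae_bound (ae_of_all _ hpt)
  refine le_of_forall_pos_le_add fun ε hε => ?_
  have hε' : 0 < ε / Real.exp (rate α κ * t) := by positivity
  have := key (a + b + ε / Real.exp (rate α κ * t)) (by linarith)
  rw [mul_add, mul_div_cancel₀ _ (Real.exp_pos _).ne'] at this
  exact this

lemma npLinf_le (h : IsFlow α κ T u W M) (hα : 0 < α) (hκ : 0 < κ) {p : ℝ} (hp : 1 < p)
    (hp2 : p < 2) {t : ℝ} (ht : t ∈ Icc 0 T) {F : 𝓢(Plane, ℝ)}
    (hF : F = good α κ W M t ∨ F = M t) :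
    npLinf p F ≤ Real.exp (2 * rate α κ * T) *
      (npLinf p (good α κ W M 0) + npLinf p (M 0)) := by
  have hK := rate_pos hα hκ
  have h1 := h.eLpNorm_le hα hκ hp hp2 ht hF
  have h2 := h.eLpNorm_top_le hα hκ ht hF
  have e1 : Real.exp (2 * rate α κ * t) ≤ Real.exp (2 * rate α κ * T) := by
    gcongr; exact ht.2
  have e2 : Real.exp (rate α κ * t) ≤ Real.exp (2 * rate α κ * T) := by
    rw [Real.exp_le_exp]
    nlinarith [ht.1, ht.2]
  simp only [npLinf]
  have h1' := h1.trans (mul_le_mul_of_nonneg_right e1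
    (add_nonneg ENNReal.toReal_nonneg ENNReal.toReal_nonneg))
  have h2' := h2.trans (mul_le_mul_of_nonneg_right e2
    (add_nonneg ENNReal.toReal_nonneg ENNReal.toReal_nonneg))
  linarith

/-- The squared `L²` norm of the gradient of the microrotation. -/
def dissipation (M : ℝ → 𝓢(Plane, ℝ)) (t : ℝ) : ℝ :=
  ∫ x, (pd 0 (M t) x ^ 2 + pd 1 (M t) x ^ 2)

lemma continuousOn_dissipation (h : IsFlow α κ T u W M) :
    ContinuousOn (dissipation M) (Icc 0 T) := by
  have h1 (i : Fin 2) : ContinuousOn (fun t => ∫ x, pd i (M t) x ^ 2) (Icc 0 T) := by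
    simpa [schwartzPd_coe] using
      continuousOn_integral_comp ((continuous_schwartzPd i).comp h.continuous_micro) T
        (isEntropy_even_pow le_rfl).contDiff_one (isEntropy_even_pow le_rfl).zero
  refine ((h1 0).add (h1 1)).congr fun t _ => ?_
  exact integral_add (integrable_pd_sq 0 _) (integrable_pd_sq 1 _)

lemma integral_dissipation_le (h : IsFlow α κ T u W M) (hα : 0 < α) (hκ : 0 < κ) {p : ℝ}
    (hp : 1 < p) (hp2 : p < 2) (hT : 0 ≤ T) :
    2 * κ * ∫ t in (0 : ℝ)..T, dissipation M t ≤ Real.exp ((2 * rate α κ + α) * T) *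
      (npLinf p (good α κ W M 0) + npLinf p (M 0)) ^ 2 := by
  set A := npLinf p (good α κ W M 0) + npLinf p (M 0)
  have hK := rate_pos hα hκ
  have hsq : IsEntropy (fun s => s ^ 2) 2 := by
    simpa using isEntropy_even_pow (le_refl 1)
  have hA : entropy α κ W M (fun s => s ^ 2) 0 ≤ A ^ 2 := by
    have h1 := integral_sq_le_npLinf_sq (good α κ W M 0) (by linarith) hp2
    have h2 := integral_sq_le_npLinf_sq (M 0) (by linarith) hp2
    have h3 := npLinf_nonneg p (good α κ W M 0)
    have h4 := npLinf_nonneg p (M 0)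
    rw [entropy]
    nlinarith [mul_nonneg h3 h4]
  have hE0 : 0 ≤ entropy α κ W M (fun s => s ^ 2) 0 :=
    add_nonneg (integral_nonneg fun x => sq_nonneg _) (integral_nonneg fun x => sq_nonneg _)
  have hE (t : ℝ) (ht : t ∈ Icc 0 T) :
      entropy α κ W M (fun s => s ^ 2) t ≤ Real.exp (2 * rate α κ * T) * A ^ 2 := by
    refine (h.entropy_le hα hκ hsq ht).trans ?_
    gcongr
    exact ht.2
  have hI (F : 𝓢(Plane, ℝ)) : Integrable fun x => F x ^ 2 :=
    integrable_comp hsq.contDiff_one hsq.zero F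
  have hd2 (s : ℝ) : deriv (deriv fun s : ℝ => s ^ 2) s = 2 := by
    have : deriv (fun s : ℝ => s ^ 2) = fun s => 2 * s := by ext s; simp
    rw [this]
    simp
  have hintg : IntegrableOn (dissipation M) (Icc 0 T) :=
    h.continuousOn_dissipation.integrableOn_Icc
  have hintg₂ : IntegrableOn (fun t => α * (Real.exp (2 * rate α κ * T) * A ^ 2) -
      2 * κ * dissipation M t) (Icc 0 T) :=
    (continuousOn_const.sub (h.continuousOn_dissipation.const_mul _)).integrableOn_Icc
  have key := intervalIntegral.sub_le_integral_of_hasDeriv_right_of_le hT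
    (continuousOn_integral_comp h.continuous_micro T hsq.contDiff_one hsq.zero)
    (fun t ht => (h.hasDerivAt_entropy_micro hsq ht).hasDerivWithinAt)
    (φ := fun t => α * (Real.exp (2 * rate α κ * T) * A ^ 2) - 2 * κ * dissipation M t)
    hintg₂ (fun t ht => by
      simp only [hd2]
      rw [integral_const_mul, ← dissipation]
      have h1 : ∫ x, deriv (fun s : ℝ => s ^ 2) (M t x) * (α * W t x) ≤
          α * entropy α κ W M (fun s => s ^ 2) t := by
        rw [entropy, ← integral_add (hI _) (hI _), ← integral_const_mul]
        refine integral_mono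
          (integrable_comp_mul (hsq.contDiff_one.continuous_deriv le_rfl) (M t)
            ((W t).integrable.const_mul α))
          (((hI _).add (hI _)).const_mul α) fun x => ?_
        have hc : 0 < α / κ := by positivity
        have hW : W t x = good α κ W M t x - α / κ * M t x := by rw [good_apply]; ring
        simp only [hW, deriv_pow_field]
        have : 2 * M t x * (good α κ W M t x - α / κ * M t x) ≤
            good α κ W M t x ^ 2 + M t x ^ 2 := by
          nlinarith [sq_nonneg (good α κ W M t x - M t x), mul_nonneg hc.le (sq_nonneg (M t x))]
        have := mul_le_mul_of_nonneg_left this hα.le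
        norm_num
        linarith
      have h2 := mul_le_mul_of_nonneg_left (hE t (Ioo_subset_Icc_self ht)) hα.le
      linarith)
  have hintg' : IntervalIntegrable (dissipation M) volume 0 T :=
    (intervalIntegrable_iff_integrableOn_Icc_of_le hT).mpr hintg
  rw [intervalIntegral.integral_sub intervalIntegrable_const (hintg'.const_mul _),
    intervalIntegral.integral_const, intervalIntegral.integral_const_mul] at key
  have hM0 : ∫ x, M 0 x ^ 2 ≤ A ^ 2 :=
    le_trans (le_add_of_nonneg_left (integral_nonneg fun x => sq_nonneg _)) hA
  have hMT : 0 ≤ ∫ x, M T x ^ 2 := integral_nonneg fun x => sq_nonneg _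
  have e1 : Real.exp ((2 * rate α κ + α) * T) =
      Real.exp (2 * rate α κ * T) * Real.exp (α * T) := by rw [← Real.exp_add]; ring_nf
  have e2 : α * T + 1 ≤ Real.exp (α * T) := Real.add_one_le_exp _
  have e3 : 1 ≤ Real.exp (2 * rate α κ * T) := Real.one_le_exp (by positivity)
  rw [e1]
  have e4 := mul_le_mul_of_nonneg_left e2
    (by positivity : 0 ≤ Real.exp (2 * rate α κ * T) * A ^ 2)
  have e5 := mul_le_mul_of_nonneg_right e3 (sq_nonneg A)
  simp only [smul_eq_mul, sub_zero] at key
  linarith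

end IsFlow

lemma pd_add (i : Fin 2) {f g : Plane → ℝ} {x : Plane} (hf : DifferentiableAt ℝ f x)
    (hg : DifferentiableAt ℝ g x) : pd i (fun y => f y + g y) x = pd i f x + pd i g x := by
  simp only [pd]
  rw [fderiv_fun_add hf hg]; rfl

lemma pd_sub (i : Fin 2) {f g : Plane → ℝ} {x : Plane} (hf : DifferentiableAt ℝ f x)
    (hg : DifferentiableAt ℝ g x) : pd i (fun y => f y - g y) x = pd i f x - pd i g x := by
  simp only [pd]
  rw [fderiv_fun_sub hf hg]; rfl

lemma pd_const_mul (i : Fin 2) (c : ℝ) {f : Plane → ℝ} {x : Plane}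
    (hf : DifferentiableAt ℝ f x) : pd i (fun y => c * f y) x = c * pd i f x := by
  simp only [pd]
  rw [fderiv_const_mul hf]; rfl

lemma smooth_fderiv_apply {E : Type*} [NormedAddCommGroup E] [NormedSpace ℝ E] {g : E → ℝ}
    (hg : ContDiff ℝ (⊤ : ℕ∞) g) (v : E) : ContDiff ℝ (⊤ : ℕ∞) fun p => fderiv ℝ g p v :=
  (hg.fderiv_right (m := (⊤ : ℕ∞)) (by simp)).clm_apply contDiff_const

lemma smooth_pd (i : Fin 2) {f : Plane → ℝ} (hf : ContDiff ℝ (⊤ : ℕ∞) f) :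
    ContDiff ℝ (⊤ : ℕ∞) (pd i f) :=
  smooth_fderiv_apply hf _

lemma fderiv_fderiv_apply_comm {E : Type*} [NormedAddCommGroup E] [NormedSpace ℝ E] {g : E → ℝ}
    (hg : ContDiff ℝ (⊤ : ℕ∞) g) (v w p : E) :
    fderiv ℝ (fun q => fderiv ℝ g q v) p w = fderiv ℝ (fun q => fderiv ℝ g q w) p v := by
  have hd : DifferentiableAt ℝ (fderiv ℝ g) p :=
    (hg.fderiv_right (m := (⊤ : ℕ∞)) (by simp)).differentiable (by simp) p
  have h (v w : E) : fderiv ℝ (fun q => fderiv ℝ g q v) p w = fderiv ℝ (fderiv ℝ g) p w v := by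
    have := hd.hasFDerivAt.clm_apply (hasFDerivAt_const v p)
    rw [this.fderiv]; simp
  rw [h, h]
  exact (hg.contDiffAt.isSymmSndFDerivAt (by rw [minSmoothness_of_isRCLikeNormedField]; exact WithTop.coe_le_coe.mpr le_top)) w v

lemma pd_comm (i j : Fin 2) {f : Plane → ℝ} (hf : ContDiff ℝ (⊤ : ℕ∞) f) (x : Plane) :
    pd i (pd j f) x = pd j (pd i f) x :=
  fderiv_fderiv_apply_comm hf _ _ x

section SpaceTime

variable {f : ℝ → Plane → ℝ}

lemma smooth_slice (hf : ContDiff ℝ (⊤ : ℕ∞) ↿f) (t : ℝ) : ContDiff ℝ (⊤ : ℕ∞) (f t) :=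
  hf.comp (contDiff_const.prodMk contDiff_id)

lemma hasDerivAt_slice {g : ℝ × Plane → ℝ} (hg : ContDiff ℝ (⊤ : ℕ∞) g) (t : ℝ) (x : Plane) :
    HasDerivAt (fun s => g (s, x)) (fderiv ℝ g (t, x) (1, 0)) t :=
  ((hg.differentiable (by simp) (t, x)).hasFDerivAt).comp_hasDerivAt t
    ((hasDerivAt_id t).prodMk (hasDerivAt_const t x))

lemma pd_slice {g : ℝ × Plane → ℝ} (hg : ContDiff ℝ (⊤ : ℕ∞) g) (i : Fin 2) (t : ℝ) (x : Plane) :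
    pd i (fun y => g (t, y)) x = fderiv ℝ g (t, x) (0, EuclideanSpace.single i 1) := by
  have := ((hg.differentiable (by simp) (t, x)).hasFDerivAt).comp x
    ((hasFDerivAt_const t x).prodMk (hasFDerivAt_id x))
  have h2 : HasFDerivAt (fun y => g (t, y)) _ x := this
  rw [pd, h2.fderiv]
  simp

lemma hasDerivAt_time (hf : ContDiff ℝ (⊤ : ℕ∞) ↿f) (t : ℝ) (x : Plane) :
    HasDerivAt (fun s => f s x) (deriv (fun s => f s x) t) t :=
  (hasDerivAt_slice hf t x).differentiableAt.hasDerivAt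

lemma hasDerivAt_pd (hf : ContDiff ℝ (⊤ : ℕ∞) ↿f) (i : Fin 2) (t : ℝ) (x : Plane) :
    HasDerivAt (fun s => pd i (f s) x) (pd i (fun y => deriv (fun s => f s y) t) x) t := by
  have h1 (y : Plane) : deriv (fun s => f s y) t = fderiv ℝ (↿f) (t, y) (1, 0) :=
    (hasDerivAt_slice hf t y).deriv
  have h2 (s : ℝ) : pd i (f s) x = fderiv ℝ (↿f) (s, x) (0, EuclideanSpace.single i 1) :=
    pd_slice hf i s x
  simp only [h1, h2]
  rw [pd_slice (smooth_fderiv_apply hf (1, 0)) i t x, fderiv_fderiv_apply_comm hf]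
  exact hasDerivAt_slice (smooth_fderiv_apply hf _) t x

end SpaceTime

/-- The curl of the momentum equation in two dimensions. -/
lemma curl_momentum {a b m P : Plane → ℝ} (ha : ContDiff ℝ (⊤ : ℕ∞) a)
    (hb : ContDiff ℝ (⊤ : ℕ∞) b) (hm : ContDiff ℝ (⊤ : ℕ∞) m) (hP : ContDiff ℝ (⊤ : ℕ∞) P)
    (hdiv : ∀ x, pd 0 a x + pd 1 b x = 0) (α : ℝ) (x : Plane) :
    pd 0 (fun y => -α * pd 0 m y - (a y * pd 0 b y + b y * pd 1 b y) - pd 1 P y) x -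
      pd 1 (fun y => α * pd 1 m y - (a y * pd 0 a y + b y * pd 1 a y) - pd 0 P y) x =
    -α * lap m x - (a x * pd 0 (fun y => pd 0 b y - pd 1 a y) x +
      b x * pd 1 (fun y => pd 0 b y - pd 1 a y) x) := by
  have d {f : Plane → ℝ} (hf : ContDiff ℝ (⊤ : ℕ∞) f) : DifferentiableAt ℝ f x :=
    hf.differentiable (by simp) x
  have dp {f : Plane → ℝ} (hf : ContDiff ℝ (⊤ : ℕ∞) f) (i : Fin 2) :
      DifferentiableAt ℝ (pd i f) x := d (smooth_pd i hf)
  have expand (i j k : Fin 2) (c : ℝ) {f : Plane → ℝ} (hf : ContDiff ℝ (⊤ : ℕ∞) f) :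
      pd i (fun y => c * pd j m y - (a y * pd 0 f y + b y * pd 1 f y) - pd k P y) x =
        c * pd i (pd j m) x - ((a x * pd i (pd 0 f) x + pd i a x * pd 0 f x) +
          (b x * pd i (pd 1 f) x + pd i b x * pd 1 f x)) - pd i (pd k P) x := by
    have da := (d ha).fun_mul (dp hf 0)
    have db := (d hb).fun_mul (dp hf 1)
    have dm := (dp hm j).const_mul c
    rw [pd_sub i (dm.fun_sub (da.fun_add db)) (dp hP k), pd_sub i dm (da.fun_add db),
      pd_const_mul i c (dp hm j), pd_add i da db, pd_mul i (d ha) (dp hf 0),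
      pd_mul i (d hb) (dp hf 1)]
  rw [expand 0 0 1 (-α) hb, expand 1 1 0 α ha, pd_sub 0 (dp hb 0) (dp ha 1),
    pd_sub 1 (dp hb 0) (dp ha 1), lap, pd_comm 0 1 hP, pd_comm 0 1 hb, pd_comm 0 1 ha]
  linear_combination (pd 1 a x - pd 0 b x) * hdiv x

lemma norm_gradient_sq (f : Plane → ℝ) (x : Plane) :
    ‖gradient f x‖ ^ 2 = pd 0 f x ^ 2 + pd 1 f x ^ 2 := by
  have h (i : Fin 2) : gradient f x i = pd i f x := by
    have := InnerProductSpace.toDual_symm_apply (𝕜 := ℝ) (x := EuclideanSpace.single i (1 : ℝ))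
      (y := fderiv ℝ f x)
    rw [EuclideanSpace.inner_single_right] at this
    simpa [gradient, pd] using this
  rw [EuclideanSpace.norm_sq_eq, Fin.sum_univ_two, h, h]
  simp

/-- global a priori estimate. There exist `C₀, K₀ > 0` depending
only on `α, κ` such that every smooth solution `(u, m, P)` of the reduced micropolar
system on `[0,T] × ℝ²` (with `u` bounded and `ω(t,·), m(t,·)` Schwartz, depending
continuously on `t`) satisfies
`‖ω(t)‖_{L^{p0}∩L^∞} + ‖m(t)‖_{L^{p0}∩L^∞} + κ(∫₀ᵀ‖∇m‖²_{L²})^{1/2}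
  ≤ C₀ (‖ω(0)‖_{L^{p0}∩L^∞} + ‖m(0)‖_{L^{p0}∩L^∞}) e^{K₀T}` for all `t ∈ [0,T]`. -/
theorem apriori_estimate (α κ : ℝ) (hα : 0 < α) (hκ : 0 < κ) :
    ∃ C₀ : ℝ, 0 < C₀ ∧ ∃ K₀ : ℝ, 0 < K₀ ∧
    ∀ (p0 : ℝ), 1 < p0 → p0 < 2 →
    ∀ (T : ℝ), 0 < T →
    ∀ (u : ℝ → Plane → Plane) (m P : ℝ → Plane → ℝ),
      ContDiff ℝ (⊤ : ℕ∞) ↿u → ContDiff ℝ (⊤ : ℕ∞) ↿m → ContDiff ℝ (⊤ : ℕ∞) ↿P →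
      (∃ B : ℝ, ∀ t x, ‖u t x‖ ≤ B) →
      -- first component of the momentum equation, with ∇^⊥m = (−∂₂m, ∂₁m)
      (∀ t ∈ Icc (0:ℝ) T, ∀ x : Plane,
        deriv (fun s => u s x 0) t
          + (u t x 0 * pd 0 (fun y => u t y 0) x + u t x 1 * pd 1 (fun y => u t y 0) x)
          + pd 0 (P t) x = -α * (-(pd 1 (m t) x))) →
      -- second component of the momentum equation
      (∀ t ∈ Icc (0:ℝ) T, ∀ x : Plane,
        deriv (fun s => u s x 1) t
          + (u t x 0 * pd 0 (fun y => u t y 1) x + u t x 1 * pd 1 (fun y => u t y 1) x)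
          + pd 1 (P t) x = -α * pd 0 (m t) x) →
      -- microrotation equation
      (∀ t ∈ Icc (0:ℝ) T, ∀ x : Plane,
        deriv (fun s => m s x) t
          + (u t x 0 * pd 0 (m t) x + u t x 1 * pd 1 (m t) x)
          - κ * lap (m t) x = α * vort u t x) →
      -- incompressibility
      (∀ t x, pd 0 (fun y => u t y 0) x + pd 1 (fun y => u t y 1) x = 0) →
      -- ω(t,·) and m(t,·) are Schwartz functions depending continuously on t
      (∃ W : ℝ → SchwartzMap Plane ℝ, Continuous W ∧ ∀ t x, vort u t x = W t x) →
      (∃ M : ℝ → SchwartzMap Plane ℝ, Continuous M ∧ ∀ t x, m t x = M t x) →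
      ∀ t ∈ Icc (0:ℝ) T,
        npLinf p0 (vort u t) + npLinf p0 (m t)
            + κ * Real.sqrt (∫ s in (0:ℝ)..T, ∫ x : Plane, ‖gradient (m s) x‖ ^ 2)
          ≤ C₀ * (npLinf p0 (vort u 0) + npLinf p0 (m 0)) * Real.exp (K₀ * T) := by
  have hc : 0 < α / κ := by positivity
  have hK := IsFlow.rate_pos hα hκ
  refine ⟨(3 + α / κ + κ) * (1 + α / κ), by positivity, 2 * IsFlow.rate α κ + α, by positivity, ?_⟩
  rintro p hp hp2 T hT u m P hu hm hP hB e₀ e₁ em hdiv ⟨W, hWc, hW⟩ ⟨M, hMc, hM⟩ t ht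
  have hWt (t : ℝ) : vort u t = W t := funext (hW t)
  have hMt (t : ℝ) : m t = M t := funext (hM t)
  have hui (i : Fin 2) : ContDiff ℝ (⊤ : ℕ∞) ↿(fun t x => u t x i) := by
    have : (↿fun t x => u t x i) = fun z : ℝ × Plane => (↿u) z i := rfl
    rw [this]
    fun_prop
  have hflow : IsFlow α κ T u W M := by
    refine ⟨fun t => ?_, hB, hdiv, hWc, hMc, fun t ht x => ?_, fun t ht x => ?_⟩
    · exact (hu.comp (contDiff_const.prodMk contDiff_id) : ContDiff ℝ (⊤ : ℕ∞) (u t)).of_le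
        (by exact_mod_cast le_top)
    · have h0 : (fun y => deriv (fun s => u s y 0) t) = fun y => α * pd 1 (m t) y -
          (u t y 0 * pd 0 (fun y => u t y 0) y + u t y 1 * pd 1 (fun y => u t y 0) y) -
          pd 0 (P t) y := by
        ext y; linear_combination e₀ t ht y
      have h1 : (fun y => deriv (fun s => u s y 1) t) = fun y => -α * pd 0 (m t) y -
          (u t y 0 * pd 0 (fun y => u t y 1) y + u t y 1 * pd 1 (fun y => u t y 1) y) -
          pd 1 (P t) y := by
        ext y; linear_combination e₁ t ht y
      have hd := (hasDerivAt_pd (hui 1) 0 t x).fun_sub (hasDerivAt_pd (hui 0) 1 t x)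
      rw [h0, h1, curl_momentum (smooth_slice (hui 0) t) (smooth_slice (hui 1) t)
        (smooth_slice hm t) (smooth_slice hP t) (hdiv t)] at hd
      rw [← hMt, ← hWt]
      simp only [← hW]
      exact hd
    · have h1 := em t ht x
      have hd := hasDerivAt_time hm t x
      rw [← hMt, ← hW]
      simp only [← hM]
      exact hd.congr_deriv (by linear_combination h1)
  simp only [hWt, hMt, norm_gradient_sq]
  change _ + κ * √(∫ s in (0 : ℝ)..T, IsFlow.dissipation M s) ≤ _
  set I := ∫ s in (0 : ℝ)..T, IsFlow.dissipation M s
  set A := npLinf p (IsFlow.good α κ W M 0) + npLinf p (M 0)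
  set N₀ := npLinf p (W 0) + npLinf p (M 0)
  have hA0 : 0 ≤ A := add_nonneg (npLinf_nonneg _ _) (npLinf_nonneg _ _)
  have hI0 : 0 ≤ I := intervalIntegral.integral_nonneg hT.le fun s _ =>
    integral_nonneg fun x => by positivity
  set e := Real.exp ((2 * IsFlow.rate α κ + α) * T)
  have he : Real.exp (2 * IsFlow.rate α κ * T) ≤ e := Real.exp_le_exp.mpr (by nlinarith)
  have he1 : 1 ≤ e := Real.one_le_exp (by positivity)
  have hΓ := (hflow.npLinf_le hα hκ hp hp2 ht (Or.inl rfl)).trans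
    (mul_le_mul_of_nonneg_right he hA0)
  have hM' := (hflow.npLinf_le hα hκ hp hp2 ht (Or.inr rfl)).trans
    (mul_le_mul_of_nonneg_right he hA0)
  have hω : npLinf p (W t) ≤ npLinf p (IsFlow.good α κ W M t) + α / κ * npLinf p (M t) := by
    have := npLinf_add_const_smul_le (IsFlow.good α κ W M t) (M t) (-(α / κ)) hp.le
    rw [abs_neg, abs_of_pos hc] at this
    simpa [IsFlow.good_apply] using this
  have hA : A ≤ (1 + α / κ) * N₀ := by
    have := npLinf_add_const_smul_le (W 0) (M 0) (α / κ) hp.le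
    simp only [← IsFlow.good_apply, abs_of_pos hc] at this
    have h1 := npLinf_nonneg p (W 0)
    simp only [A, N₀]
    nlinarith [mul_nonneg hc.le h1]
  have hdiss := hflow.integral_dissipation_le hα hκ hp hp2 hT.le
  have hsqrt : κ * √I ≤ (1 + κ) * (e * A) := by
    rw [← pow_le_pow_iff_left₀ (by positivity) (by positivity) two_ne_zero, mul_pow,
      Real.sq_sqrt hI0]
    have h1 : κ * (2 * κ * I) ≤ κ * (e * A ^ 2) := mul_le_mul_of_nonneg_left hdiss hκ.le
    have h2 : e * A ^ 2 ≤ (e * A) ^ 2 := by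
      rw [mul_pow]
      gcongr
      nlinarith
    have h3 := mul_le_mul_of_nonneg_left h2 hκ.le
    have h4 : 0 ≤ κ ^ 2 * I := by positivity
    have h5 : 0 ≤ (1 + κ + κ ^ 2) * (e * A) ^ 2 := by positivity
    nlinarith
  have hM'' := mul_le_mul_of_nonneg_left hM' hc.le
  calc _ ≤ (3 + α / κ + κ) * (e * A) := by linarith
    _ ≤ (3 + α / κ + κ) * (e * ((1 + α / κ) * N₀)) := by gcongr
    _ = _ := by ring
end
end

section
/- Let T > 0, K > 0 and p > 1. Let E : [0,T] → [0,∞) be continuous, differentiable on (0,T), with E(0) = 0 and E′(t) ≤ K p (E(t))^{1 − 1/p} for all t ∈ (0,T). Then E(t) ≤ (K t)^p for every t ∈ [0,T]. -/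
open Set
noncomputable section

/-- Osgood/comparison lemma. If `E : [0,T] → [0,∞)` is continuous,
differentiable on `(0,T)`, with `E(0) = 0` and `E′(t) ≤ K p (E t)^{1 − 1/p}` on
`(0,T)`, then `E(t) ≤ (K t)^p` on `[0,T]`. -/
theorem ode_comparison (T K p : ℝ) (hT : 0 < T) (hK : 0 < K) (hp : 1 < p)
    (E : ℝ → ℝ) (hcont : ContinuousOn E (Icc 0 T))
    (hnonneg : ∀ t ∈ Icc (0:ℝ) T, 0 ≤ E t)
    (hdiff : ∀ t ∈ Ioo (0:ℝ) T, DifferentiableAt ℝ E t)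
    (hineq : ∀ t ∈ Ioo (0:ℝ) T, deriv E t ≤ K * p * E t ^ (1 - 1/p))
    (h0 : E 0 = 0) :
    ∀ t ∈ Icc (0:ℝ) T, E t ≤ (K * t) ^ p := by
  intro t ht
  have hp0 : 0 < p := by linarith
  have hKt : 0 ≤ K * t := mul_nonneg hK.le ht.1
  suffices h : E t ^ (1 / p) ≤ K * t by
    have h' := Real.rpow_le_rpow (Real.rpow_nonneg (hnonneg t ht) _) h hp0.le
    rwa [← Real.rpow_mul (hnonneg t ht), one_div_mul_cancel hp0.ne', Real.rpow_one] at h'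
  refine le_of_forall_pos_le_add fun δ hδ => ?_
  have hε : 0 < δ ^ p := Real.rpow_pos_of_pos hδ p
  have hpos : ∀ s ∈ Icc (0:ℝ) T, 0 < E s + δ ^ p := fun s hs =>
    add_pos_of_nonneg_of_pos (hnonneg s hs) hε
  have hderiv : ∀ s ∈ Ioo (0:ℝ) T, HasDerivAt (fun s => (E s + δ ^ p) ^ (1 / p))
      (deriv E s * (1 / p) * (E s + δ ^ p) ^ (1 / p - 1)) s := fun s hs =>
    ((hdiff s hs).hasDerivAt.add_const _).rpow_const
      (Or.inl (hpos s (Ioo_subset_Icc_self hs)).ne')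
  have hbound : ∀ s ∈ Ioo (0:ℝ) T,
      deriv E s * (1 / p) * (E s + δ ^ p) ^ (1 / p - 1) ≤ K := by
    intro s hs
    have hs' := Ioo_subset_Icc_self hs
    have hexp : 0 ≤ 1 - 1 / p := by
      rw [sub_nonneg, div_le_one hp0]
      exact hp.le
    have hdE : deriv E s ≤ K * p * (E s + δ ^ p) ^ (1 - 1 / p) :=
      (hineq s hs).trans (mul_le_mul_of_nonneg_left
        (Real.rpow_le_rpow (hnonneg s hs') (by linarith) hexp) (by positivity))
    have hnn := Real.rpow_nonneg (hpos s hs').le (1 / p - 1)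
    calc deriv E s * (1 / p) * (E s + δ ^ p) ^ (1 / p - 1)
        ≤ K * p * (E s + δ ^ p) ^ (1 - 1 / p) * (1 / p) * (E s + δ ^ p) ^ (1 / p - 1) := by
          gcongr
      _ = K * ((E s + δ ^ p) ^ (1 - 1 / p) * (E s + δ ^ p) ^ (1 / p - 1)) := by
          field_simp
      _ = K := by
          rw [← Real.rpow_add (hpos s hs')]
          simp
  have hmv := (convex_Icc (0:ℝ) T).image_sub_le_mul_sub_of_deriv_le
    (f := fun s => (E s + δ ^ p) ^ (1 / p)) (C := K)
    ((hcont.add continuousOn_const).rpow_const fun s hs => Or.inl (hpos s hs).ne')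
    (by
      rw [interior_Icc]
      exact fun s hs => (hderiv s hs).differentiableAt.differentiableWithinAt)
    (by
      rw [interior_Icc]
      exact fun s hs => (hderiv s hs).deriv.trans_le (hbound s hs))
    0 (left_mem_Icc.2 hT.le) t ht ht.1
  have hδp : (δ ^ p) ^ (1 / p) = δ := by
    rw [← Real.rpow_mul hδ.le, mul_one_div_cancel hp0.ne', Real.rpow_one]
  simp only [h0, zero_add, hδp, sub_zero] at hmv
  have hmono : E t ^ (1 / p) ≤ (E t + δ ^ p) ^ (1 / p) :=
    Real.rpow_le_rpow (hnonneg t ht) (by linarith) (by positivity)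
  linarith
end
end

section
/- Let T > 0, K > 0 and p₀ > 1. Let E : [0,T] → [0,∞) be continuous, differentiable on (0,T), with E(0) = 0, and suppose that for every p ≥ p₀ and every t ∈ (0,T) one has E′(t) ≤ K p (E(t))^{1 − 1/p}. Then E(t) = 0 for every t ∈ [0,T]. -/
open Set
noncomputable section

/-- If `E` vanishes at `a`, is positive afterwards and satisfies
`deriv E ≤ K p E ^ (1 - 1 / p)`, then `E ^ (1 / p)` grows at most linearly with slope `K`. -/
theorem rpow_inv_le_mul_sub_of_deriv_le {a b K p : ℝ} (hab : a ≤ b) (hp : 0 < p) {E : ℝ → ℝ}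
    (hcont : ContinuousOn E (Icc a b)) (hpos : ∀ t ∈ Ioo a b, 0 < E t)
    (hdiff : ∀ t ∈ Ioo a b, DifferentiableAt ℝ E t)
    (hineq : ∀ t ∈ Ioo a b, deriv E t ≤ K * p * E t ^ (1 - 1 / p)) (ha : E a = 0) :
    E b ^ (1 / p) ≤ K * (b - a) := by
  have hder : ∀ t ∈ Ioo a b, HasDerivAt (fun t ↦ E t ^ (1 / p))
      (deriv E t * (1 / p) * E t ^ (1 / p - 1)) t := fun t ht ↦
    (hdiff t ht).hasDerivAt.rpow_const (Or.inl (hpos t ht).ne')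
  have hmvt := (convex_Icc a b).image_sub_le_mul_sub_of_deriv_le (C := K)
    (f := fun t ↦ E t ^ (1 / p))
    (hcont.rpow_const fun _ _ ↦ Or.inr (by positivity))
    (by
      rw [interior_Icc]
      exact fun t ht ↦ (hder t ht).differentiableAt.differentiableWithinAt)
    (by
      rw [interior_Icc]
      intro t ht
      rw [(hder t ht).deriv]
      have hE := hpos t ht
      calc deriv E t * (1 / p) * E t ^ (1 / p - 1)
          ≤ K * p * E t ^ (1 - 1 / p) * (1 / p) * E t ^ (1 / p - 1) := by
            gcongr
            exact hineq t ht
        _ = K * (E t ^ (1 - 1 / p) * E t ^ (1 / p - 1)) := by field_simp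
        _ = K := by rw [← Real.rpow_add hE]; simp)
    a (left_mem_Icc.2 hab) b (right_mem_Icc.2 hab) hab
  simpa [ha, Real.zero_rpow (inv_ne_zero hp.ne')] using hmvt

/-- A nonnegative continuous function vanishing at `a` but not at `t` has a last zero
before `t`. -/
theorem exists_last_zero {a t : ℝ} (hat : a ≤ t) {E : ℝ → ℝ} (hcont : ContinuousOn E (Icc a t))
    (hnonneg : ∀ x ∈ Icc a t, 0 ≤ E x) (ha : E a = 0) (ht : E t ≠ 0) :
    ∃ s ∈ Ico a t, E s = 0 ∧ ∀ x ∈ Ioc s t, 0 < E x := by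
  have hclosed : IsClosed (Icc a t ∩ E ⁻¹' {0}) :=
    hcont.preimage_isClosed_of_isClosed isClosed_Icc isClosed_singleton
  have hcompact : IsCompact (Icc a t ∩ E ⁻¹' {0}) :=
    isCompact_Icc.of_isClosed_subset hclosed inter_subset_left
  obtain ⟨s, ⟨hs, hs0⟩, hmax⟩ := hcompact.exists_isGreatest ⟨a, left_mem_Icc.2 hat, ha⟩
  have hs0 : E s = 0 := hs0
  refine ⟨s, ⟨hs.1, hs.2.lt_of_ne ?_⟩, hs0, fun x hx ↦ ?_⟩
  · rintro rfl
    exact ht hs0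
  · have hx' : x ∈ Icc a t := ⟨hs.1.trans hx.1.le, hx.2⟩
    exact (hnonneg x hx').lt_of_ne fun h ↦ hx.1.not_ge (hmax ⟨hx', h.symm⟩)

/-- Yudovich's uniqueness lemma. If `E : [0,T] → [0,∞)` is
continuous, differentiable on `(0,T)`, with `E(0) = 0`, and for every `p ≥ p₀`
one has `E′(t) ≤ K p (E t)^{1 − 1/p}` on `(0,T)`, then `E ≡ 0` on `[0,T]`. -/
theorem yudovich_vanishing (T K p₀ : ℝ) (hT : 0 < T) (hK : 0 < K) (hp₀ : 1 < p₀)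
    (E : ℝ → ℝ) (hcont : ContinuousOn E (Icc 0 T))
    (hnonneg : ∀ t ∈ Icc (0:ℝ) T, 0 ≤ E t)
    (hdiff : ∀ t ∈ Ioo (0:ℝ) T, DifferentiableAt ℝ E t)
    (hineq : ∀ p : ℝ, p₀ ≤ p → ∀ t ∈ Ioo (0:ℝ) T, deriv E t ≤ K * p * E t ^ (1 - 1/p))
    (h0 : E 0 = 0) :
    ∀ t ∈ Icc (0:ℝ) T, E t = 0 := by
  intro t ht
  by_contra hEt
  have hsub : Icc 0 t ⊆ Icc 0 T := Icc_subset_Icc_right ht.2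
  obtain ⟨s, hs, hs0, hpos⟩ := exists_last_zero ht.1 (hcont.mono hsub)
    (fun x hx ↦ hnonneg x (hsub hx)) h0 hEt
  obtain ⟨x, hsx, hxt, hxK⟩ : ∃ x, s < x ∧ x ≤ t ∧ K * (x - s) ≤ 1 / 2 := by
    refine ⟨min t (s + 1 / (2 * K)), lt_min hs.2 (by linarith [show 0 < 1 / (2 * K) by positivity]),
      min_le_left _ _, ?_⟩
    calc K * (min t (s + 1 / (2 * K)) - s) ≤ K * (s + 1 / (2 * K) - s) := by
          gcongr
          exact min_le_right _ _
      _ = 1 / 2 := by field_simp; ring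
  have hIoo : ∀ y ∈ Ioo s x, y ∈ Ioo 0 T := fun y hy ↦
    ⟨hs.1.trans_lt hy.1, hy.2.trans_le (hxt.trans ht.2)⟩
  have hbound : ∀ p, p₀ ≤ p → E x ^ (1 / p) ≤ 1 / 2 := fun p hp ↦
    (rpow_inv_le_mul_sub_of_deriv_le hsx.le (by linarith)
      (hcont.mono (Icc_subset_Icc hs.1 (hxt.trans ht.2)))
      (fun y hy ↦ hpos y ⟨hy.1, hy.2.le.trans hxt⟩) (fun y hy ↦ hdiff y (hIoo y hy))
      (fun y hy ↦ hineq p hp y (hIoo y hy)) hs0).trans hxK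
  have hlim : Filter.Tendsto (fun p : ℝ ↦ E x ^ (1 / p)) Filter.atTop (nhds 1) := by
    have hinv : Filter.Tendsto (fun p : ℝ ↦ 1 / p) Filter.atTop (nhds 0) := by
      simpa only [one_div] using tendsto_inv_atTop_zero (𝕜 := ℝ)
    simpa using (tendsto_const_nhds (x := E x)).rpow hinv (Or.inl (hpos x ⟨hsx, hxt⟩).ne')
  have := le_of_tendsto hlim (Filter.eventually_atTop.2 ⟨p₀, hbound⟩)
  norm_num at this
end
end
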